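/- For any γ ∈ [3/4, 1) and any function f : [1,∞) → (0,∞) satisfying f(1) = 1 and the log-Lipschitz condition a^{3/4} f(n) ≤ f(an) ≤ a^γ f(n) for all real a, n ≥ 1, there exist a finitely generated group G with a finite symmetric generating set and a symmetric, finitely supported random walk X_n on G (whose step distribution has support generating G) such that E|X_n| ≍ f(n) and H(X_n) ≍ f(n)²·log(n+1)/n, with implied constants depending only on γ. -/

import Mathlib

open scoped BigOperators Classical

/-- Convolution of two measures (given as weight functions) on a group. -/
noncomputable def conv {G : Type*} [Group G] (μ ν : G → ℝ) : G → ℝ :=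
  fun g => ∑' h, μ h * ν (h⁻¹ * g)

/-- The `n`-fold convolution power of `μ`; `convPow μ n` is the distribution of `X_n`. -/
noncomputable def convPow {G : Type*} [Group G] (μ : G → ℝ) : ℕ → G → ℝ
  | 0 => fun g => if g = 1 then 1 else 0
  | n + 1 => conv (convPow μ n) μ

/-- Shannon entropy of a measure on a countable group:
`H(μ) = -∑ μ(g) log μ(g)` (with `0 log 0 = 0`). -/
noncomputable def entropy {G : Type*} (μ : G → ℝ) : ℝ :=
  ∑' g, Real.negMulLog (μ g)

/-- Word length with respect to a generating set `S`. -/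
noncomputable def wordLength {G : Type*} [Group G] (S : Set G) (g : G) : ℕ :=
  sInf {n | ∃ l : List G, l.length = n ∧ (∀ x ∈ l, x ∈ S) ∧ l.prod = g}

/-- Rate of escape: `E|X_n| = ∑ μ^{*n}(g) |g|`. -/
noncomputable def speed {G : Type*} [Group G] (S : Set G) (μ : G → ℝ) (n : ℕ) : ℝ :=
  ∑' g, convPow μ n g * (wordLength S g : ℝ)

/-- `μ` is a symmetric, finitely supported probability measure whose support generates `G`. -/
structure IsStepDist {G : Type*} [Group G] (μ : G → ℝ) : Prop where
  nonneg : ∀ g, 0 ≤ μ g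
  total : ∑' g, μ g = 1
  symm : ∀ g, μ g⁻¹ = μ g
  finSupp : (Function.support μ).Finite
  gen : Subgroup.closure (Function.support μ) = ⊤

/-- `S` is a finite symmetric generating set of `G`. -/
structure IsGenSet {G : Type*} [Group G] (S : Set G) : Prop where
  finite : S.Finite
  symm : ∀ s ∈ S, s⁻¹ ∈ S
  gen : Subgroup.closure S = ⊤

namespace SPE

/-- Average over a finite alphabet. -/
noncomputable def av {A : Type} [Fintype A] (f : A → ℝ) : ℝ :=
  (Fintype.card A : ℝ)⁻¹ * ∑ a, f a

section av
variable {A : Type} [Fintype A]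

lemma av_add (f g : A → ℝ) : av (fun a => f a + g a) = av f + av g := by
  simp [av, Finset.sum_add_distrib, mul_add]

lemma av_mul_left (c : ℝ) (f : A → ℝ) : av (fun a => c * f a) = c * av f := by
  simp only [av, ← Finset.mul_sum]; ring

lemma av_const [Nonempty A] (c : ℝ) : av (fun _ : A => c) = c := by
  simp [av]

lemma av_mono {f g : A → ℝ} (h : ∀ a, f a ≤ g a) : av f ≤ av g := by
  unfold av
  exact mul_le_mul_of_nonneg_left (Finset.sum_le_sum fun a _ => h a) (by positivity)

lemma av_comm {B : Type} [Fintype B] (f : A → B → ℝ) :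
    av (fun a => av (fun b => f a b)) = av (fun b => av (fun a => f a b)) := by
  simp only [av, Finset.mul_sum]
  rw [Finset.sum_comm]
  refine Finset.sum_congr rfl fun a _ => Finset.sum_congr rfl fun b _ => by ring

lemma av_prod {B : Type} [Fintype B] (f : A × B → ℝ) :
    av f = av (fun a => av (fun b => f (a, b))) := by
  simp only [av, Finset.mul_sum, Fintype.sum_prod_type, Fintype.card_prod, Nat.cast_mul, mul_inv]
  refine Finset.sum_congr rfl fun a _ => Finset.sum_congr rfl fun b _ => by ring

lemma av_equiv {B : Type} [Fintype B] (e : B ≃ A) (f : A → ℝ) :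
    av f = av (fun b => f (e b)) := by
  simp only [av, Fintype.card_congr e]
  rw [Equiv.sum_comp e f]

lemma av_sum {ι : Type*} (s : Finset ι) (f : ι → A → ℝ) :
    av (fun a => ∑ i ∈ s, f i a) = ∑ i ∈ s, av (f i) := by
  simp only [av, Finset.mul_sum]; rw [Finset.sum_comm]

lemma av_bool (f : Bool → ℝ) : av f = (f true + f false) / 2 := by
  simp [av]; ring
end av

/-- Expectation over words of length `n` with i.i.d. uniform letters. -/
noncomputable def EL (A : Type) [Fintype A] : ℕ → (List A → ℝ) → ℝ
  | 0, f => f []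
  | n + 1, f => av fun a => EL A n (fun l => f (a :: l))

section EL
variable {A : Type} [Fintype A]

lemma EL_zero (f : List A → ℝ) : EL A 0 f = f [] := rfl
lemma EL_succ (n : ℕ) (f : List A → ℝ) :
    EL A (n + 1) f = av fun a => EL A n (fun l => f (a :: l)) := rfl

lemma EL_add (n : ℕ) (f g : List A → ℝ) :
    EL A n (fun l => f l + g l) = EL A n f + EL A n g := by
  induction n generalizing f g with
  | zero => rfl
  | succ n ih => simp only [EL_succ, ih, av_add]

lemma EL_mul_left (n : ℕ) (c : ℝ) (f : List A → ℝ) :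
    EL A n (fun l => c * f l) = c * EL A n f := by
  induction n generalizing f with
  | zero => rfl
  | succ n ih => simp only [EL_succ, ih, av_mul_left]

lemma EL_const [Nonempty A] (n : ℕ) (c : ℝ) : EL A n (fun _ => c) = c := by
  induction n with
  | zero => rfl
  | succ n ih => simp only [EL_succ, ih, av_const]

lemma EL_mono (n : ℕ) {f g : List A → ℝ} (h : ∀ l, l.length = n → f l ≤ g l) :
    EL A n f ≤ EL A n g := by
  induction n generalizing f g with
  | zero => exact h [] rfl
  | succ n ih => exact av_mono fun a => ih fun l hl => h _ (by simp [hl])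

lemma EL_congr (n : ℕ) {f g : List A → ℝ} (h : ∀ l, l.length = n → f l = g l) :
    EL A n f = EL A n g :=
  le_antisymm (EL_mono n fun l hl => (h l hl).le) (EL_mono n fun l hl => (h l hl).ge)

lemma EL_sum {ι : Type*} (n : ℕ) (s : Finset ι) (f : ι → List A → ℝ) :
    EL A n (fun l => ∑ i ∈ s, f i l) = ∑ i ∈ s, EL A n (f i) := by
  induction n generalizing f with
  | zero => rfl
  | succ n ih => simp only [EL_succ, ih, av_sum]

lemma EL_av {B : Type} [Fintype B] (n : ℕ) (f : B → List A → ℝ) :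
    EL A n (fun l => av fun b => f b l) = av fun b => EL A n (f b) := by
  induction n generalizing f with
  | zero => rfl
  | succ n ih => simp only [EL_succ, ih]; rw [av_comm]

lemma EL_snoc (n : ℕ) (f : List A → ℝ) :
    EL A (n + 1) f = EL A n (fun l => av fun a => f (l ++ [a])) := by
  induction n generalizing f with
  | zero => rfl
  | succ n ih =>
    rw [EL_succ]
    conv_lhs => simp only [ih]
    rfl

lemma EL_jensen [Nonempty A] (n : ℕ) (f : List A → ℝ) (h : ∀ l, 0 ≤ f l) :
    EL A n (fun l => Real.negMulLog (f l)) ≤ Real.negMulLog (EL A n f) := by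
  induction n generalizing f with
  | zero => exact le_rfl
  | succ n ih =>
    have h1 : EL A (n+1) (fun l => Real.negMulLog (f l)) ≤
        av fun a => Real.negMulLog (EL A n (fun l => f (a :: l))) :=
      av_mono fun a => ih _ fun l => h _
    refine h1.trans ?_
    have hn : ∀ a : A, 0 ≤ EL A n (fun l => f (a :: l)) := fun a => by
      have := EL_mono (A := A) n (f := fun _ => 0) (g := fun l => f (a :: l)) (fun l _ => h _)
      rwa [EL_const] at this
    have := Real.concaveOn_negMulLog.le_map_sum (t := (Finset.univ : Finset A))
      (w := fun _ => (Fintype.card A : ℝ)⁻¹) (p := fun a => EL A n (fun l => f (a :: l)))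
      (fun _ _ => by positivity) (by simp) (fun a _ => hn a)
    simpa [EL_succ, av, Finset.mul_sum] using this
end EL

/-- value of a lazy switch -/
def ev (e : Bool × Bool) : ℤ := (e.1.toNat : ℤ) - (e.2.toNat : ℤ)

/-- Expectation over independent lazy switches at a list of sites. -/
noncomputable def Esig {X : Type} : List X → ((X → ℤ) → ℝ) → ℝ
  | [], T => T 0
  | x :: xs, T => av fun e : Bool × Bool => Esig xs (fun F => T (Pi.single x (ev e) + F))

section Esig
variable {X : Type}

lemma av4 (f : Bool × Bool → ℝ) :
    av f = (f (true, true) + f (true, false) + f (false, true) + f (false, false)) / 4 := by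
  rw [av_prod]; simp only [av_bool]; ring

lemma Esig_nil (T : (X → ℤ) → ℝ) : Esig [] T = T 0 := rfl
lemma Esig_cons (x : X) (xs : List X) (T : (X → ℤ) → ℝ) :
  Esig (x :: xs) T = av fun e : Bool × Bool => Esig xs (fun F => T (Pi.single x (ev e) + F)) := rfl

lemma Esig_add (xs : List X) (T U : (X → ℤ) → ℝ) :
    Esig xs (fun F => T F + U F) = Esig xs T + Esig xs U := by
  induction xs generalizing T U with
  | nil => rfl
  | cons x xs ih => simp only [Esig_cons, ih, av_add]

lemma Esig_mul_left (xs : List X) (c : ℝ) (T : (X → ℤ) → ℝ) :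
    Esig xs (fun F => c * T F) = c * Esig xs T := by
  induction xs generalizing T with
  | nil => rfl
  | cons x xs ih => simp only [Esig_cons, ih, av_mul_left]

lemma Esig_const (xs : List X) (c : ℝ) : Esig xs (fun _ => c) = c := by
  induction xs with
  | nil => rfl
  | cons x xs ih => simp only [Esig_cons, ih, av_const]

lemma Esig_mono (xs : List X) {T U : (X → ℤ) → ℝ} (h : ∀ F, T F ≤ U F) :
    Esig xs T ≤ Esig xs U := by
  induction xs generalizing T U with
  | nil => exact h 0
  | cons x xs ih => exact av_mono fun e => ih fun F => h _

lemma Esig_sum {ι : Type*} (xs : List X) (s : Finset ι) (T : ι → (X → ℤ) → ℝ) :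
    Esig xs (fun F => ∑ i ∈ s, T i F) = ∑ i ∈ s, Esig xs (T i) := by
  induction xs generalizing T with
  | nil => rfl
  | cons x xs ih => simp only [Esig_cons, ih, av_sum]

lemma Esig_map (σ : Equiv.Perm X) (xs : List X) (T : (X → ℤ) → ℝ) :
    Esig (xs.map σ) T = Esig xs (fun F => T (F ∘ σ.symm)) := by
  induction xs generalizing T with
  | nil => rfl
  | cons x xs ih =>
    simp only [List.map_cons, Esig_cons, ih]
    congr 1; funext e; congr 1; funext F; congr 1
    funext y
    simp only [Pi.add_apply, Function.comp, Pi.single_apply]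
    congr 1
    by_cases h : y = σ x
    · subst h; simp
    · have : σ.symm y ≠ x := fun h' => h (by rw [← h']; simp)
      simp [h, this]

lemma Esig_sq (xs : List X) (x : X) :
    Esig xs (fun F => ((F x : ℤ) : ℝ) ^ 2) = (xs.count x : ℝ) / 2 := by
  induction xs with
  | nil => simp [Esig_nil]
  | cons y xs ih =>
    rw [Esig_cons]
    by_cases h : y = x
    · subst h
      have : ∀ e : Bool × Bool, Esig xs (fun F => (((Pi.single y (ev e) + F : X → ℤ) y : ℤ) : ℝ) ^ 2) =
         (ev e : ℝ)^2 + (2 * (ev e : ℝ)) * Esig xs (fun F => (F y : ℝ)) + (xs.count y : ℝ) / 2 := by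
        intro e
        rw [← ih, ← Esig_mul_left, ← Esig_const xs ((ev e : ℝ)^2), ← Esig_add, ← Esig_add]
        congr 1; funext F; simp; ring
      simp only [this, av4]
      simp [ev]; ring
    · have h' : x ≠ y := fun h' => h h'.symm
      simp [h, h', ih, av_const]

lemma Esig_four (xs : List X) (x : X) :
    Esig xs (fun F => ((F x : ℤ) : ℝ) ^ 4) ≤ 3 / 4 * (xs.count x : ℝ) ^ 2 := by
  induction xs with
  | nil => simp [Esig_nil]
  | cons y xs ih =>
    rw [Esig_cons]
    by_cases h : y = x
    · subst h
      have : ∀ e : Bool × Bool, Esig xs (fun F => (((Pi.single y (ev e) + F : X → ℤ) y : ℤ) : ℝ) ^ 4) =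
         (ev e : ℝ)^4 + (4 * (ev e : ℝ)) * Esig xs (fun F => (F y : ℝ)^3)
           + (6 * (ev e : ℝ)^2) * Esig xs (fun F => (F y : ℝ)^2)
           + (4 * (ev e : ℝ)^3) * Esig xs (fun F => (F y : ℝ))
           + Esig xs (fun F => (F y : ℝ)^4) := by
        intro e
        rw [← Esig_mul_left, ← Esig_mul_left, ← Esig_mul_left, ← Esig_const xs ((ev e : ℝ)^4),
          ← Esig_add, ← Esig_add, ← Esig_add, ← Esig_add]
        congr 1; funext F; simp; ring
      simp only [this, av4, Esig_sq]
      simp [ev]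
      nlinarith
    · have h' : x ≠ y := fun h' => h h'.symm
      simpa [h, h', av_const] using ih

/-- law of the sum of `L` lazy switches -/
noncomputable def pL : ℕ → ℤ → ℝ
  | 0, y => if y = 0 then 1 else 0
  | L + 1, y => av fun e : Bool × Bool => pL L (y - ev e)

lemma Esig_ind_le (xs : List X) (F₀ : X → ℤ) (T : Finset X) (hT : ∀ x ∈ xs, x ∈ T) :
    Esig xs (fun F => if F = F₀ then 1 else 0) ≤ ∏ x ∈ T, pL (xs.count x) (F₀ x) := by
  induction xs generalizing F₀ with
  | nil =>
    simp only [Esig_nil, List.count_nil, pL]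
    by_cases h : F₀ = 0
    · subst h; simp
    · have h' : (0 : X → ℤ) ≠ F₀ := fun h' => h h'.symm
      rw [if_neg h']
      exact Finset.prod_nonneg fun x _ => by split_ifs <;> norm_num
  | cons y xs ih =>
    have hy : y ∈ T := hT y (by simp)
    rw [Esig_cons]
    have h1 : ∀ e : Bool × Bool, Esig xs (fun F => if Pi.single y (ev e) + F = F₀ then (1:ℝ) else 0) ≤
        pL (xs.count y) (F₀ y - ev e) * ∏ x ∈ T.erase y, pL (xs.count x) (F₀ x) := by
      intro e
      have := ih (F₀ - Pi.single y (ev e)) (fun x hx => hT x (by simp [hx]))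
      have e1 : (fun F : X → ℤ => if Pi.single y (ev e) + F = F₀ then (1:ℝ) else 0) =
          (fun F => if F = F₀ - Pi.single y (ev e) then (1:ℝ) else 0) := by
        funext F; congr 1; rw [eq_sub_iff_add_eq, add_comm]
      rw [e1]
      refine this.trans (le_of_eq ?_)
      rw [← Finset.mul_prod_erase T _ hy]
      congr 1
      · simp
      · refine Finset.prod_congr rfl fun x hx => ?_
        have : x ≠ y := Finset.ne_of_mem_erase hx
        simp [this]
    refine (av_mono h1).trans (le_of_eq ?_)
    rw [← Finset.mul_prod_erase T (fun x => pL ((y :: xs).count x) (F₀ x)) hy]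
    have e2 : ∏ x ∈ T.erase y, pL ((y :: xs).count x) (F₀ x) = ∏ x ∈ T.erase y, pL (xs.count x) (F₀ x) := by
      refine Finset.prod_congr rfl fun x hx => ?_
      have : y ≠ x := (Finset.ne_of_mem_erase hx).symm
      simp [this]
    rw [e2]
    simp only [List.count_cons_self, pL]
    rw [mul_comm, ← av_mul_left]
    congr 1; funext e; ring

lemma pL_succ (L : ℕ) (y : ℤ) : pL (L + 1) y = (2 * pL L y + pL L (y - 1) + pL L (y + 1)) / 4 := by
  simp only [pL, av4, ev]
  simp
  ring

lemma pL_zero_of (L : ℕ) (y : ℤ) (h : y < -(L : ℤ)) : pL L y = 0 := by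
  induction L generalizing y with
  | zero => simp only [pL]; rw [if_neg]; intro h'; simp [h'] at h
  | succ L ih =>
    push_cast at h
    rw [pL_succ, ih _ (by omega), ih _ (by omega), ih _ (by omega)]; simp

lemma pL_eq (L k : ℕ) : pL L ((k : ℤ) - L) = ((2 * L).choose k : ℝ) / 4 ^ L := by
  induction L generalizing k with
  | zero =>
    simp only [pL]
    rcases k with _ | k
    · simp
    · rw [if_neg (by push_cast; omega)]; simp
  | succ L ih =>
    rw [pL_succ]
    have e1 : ((k : ℤ) - (L + 1 : ℕ)) + 1 = (k : ℤ) - L := by push_cast; ring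
    rw [e1, ih]
    rcases k with _ | _ | k
    · rw [pL_zero_of _ _ (by push_cast; omega), pL_zero_of _ _ (by push_cast; omega)]
      simp; rw [pow_succ]; field_simp
    · have e2 : (((0 + 1 : ℕ) : ℤ) - (L + 1 : ℕ)) = ((0 : ℕ) : ℤ) - L := by push_cast; ring
      rw [e2, ih, pL_zero_of _ _ (by push_cast; omega)]
      simp; rw [pow_succ]; field_simp; ring
    · have e2 : (((k + 1 + 1 : ℕ) : ℤ) - (L + 1 : ℕ)) = ((k + 1 : ℕ) : ℤ) - L := by push_cast; ring
      have e3 : (((k + 1 : ℕ) : ℤ) - L) - 1 = ((k : ℕ) : ℤ) - L := by push_cast; ring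
      rw [e2, e3, ih, ih]
      have : (2 * (L + 1)).choose (k + 1 + 1) = (2 * L).choose k + 2 * (2 * L).choose (k + 1)
          + (2 * L).choose (k + 2) := by
        rw [show 2 * (L + 1) = 2 * L + 1 + 1 by ring, Nat.choose_succ_succ, Nat.choose_succ_succ,
          Nat.choose_succ_succ (2 * L) (k + 1)]
        ring
      rw [this]; push_cast; rw [pow_succ]; field_simp; ring

lemma cb_bound (L : ℕ) : (L.centralBinom : ℝ) ^ 2 * (2 * L + 1) ≤ (4 ^ L) ^ 2 := by
  induction L with
  | zero => simp
  | succ L ih =>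
    have h : ((L : ℝ) + 1) * ((L + 1).centralBinom : ℝ) = 2 * (2 * L + 1) * (L.centralBinom : ℝ) := by
      exact_mod_cast Nat.succ_mul_centralBinom_succ L
    have h2 : ((L + 1).centralBinom : ℝ) = 2 * (2 * L + 1) * (L.centralBinom : ℝ) / ((L : ℝ) + 1) := by
      field_simp; linarith
    rw [h2, pow_succ (4:ℝ) L, div_pow, div_mul_eq_mul_div, div_le_iff₀ (by positivity)]
    push_cast
    have h3 : (2 * (2 * (L:ℝ) + 1)) ^ 2 * (2 * (L + 1) + 1) ≤ 16 * (L + 1) ^ 2 * (2 * L + 1) := by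
      have : (0:ℝ) ≤ L := by positivity
      nlinarith
    have h4 : (0:ℝ) ≤ (L.centralBinom : ℝ) ^ 2 := by positivity
    have h5 := mul_le_mul_of_nonneg_right h3 h4
    have h6 := mul_le_mul_of_nonneg_left ih (show (0:ℝ) ≤ 16 * (L + 1) ^ 2 by positivity)
    nlinarith

lemma pL_nonneg (L : ℕ) (y : ℤ) : 0 ≤ pL L y := by
  by_cases h : y < -(L : ℤ)
  · rw [pL_zero_of L y h]
  · obtain ⟨k, hk⟩ : ∃ k : ℕ, y = (k : ℤ) - L := ⟨(y + L).toNat, by omega⟩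
    rw [hk, pL_eq]; positivity

lemma pL_le (L : ℕ) (y : ℤ) : pL L y ≤ (Real.sqrt (1 + L))⁻¹ := by
  by_cases h : y < -(L : ℤ)
  · rw [pL_zero_of L y h]; positivity
  · obtain ⟨k, hk⟩ : ∃ k : ℕ, y = (k : ℤ) - L := ⟨(y + L).toNat, by omega⟩
    rw [hk, pL_eq]
    have h1 : ((2 * L).choose k : ℝ) ≤ L.centralBinom := by
      exact_mod_cast Nat.choose_le_centralBinom k L
    refine (div_le_div_of_nonneg_right h1 (by positivity)).trans ?_
    rw [div_le_iff₀ (by positivity), ← div_eq_inv_mul, le_div_iff₀ (by positivity)]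
    refine le_of_sq_le_sq ?_ (by positivity)
    rw [mul_pow, Real.sq_sqrt (by positivity)]
    refine le_trans ?_ (cb_bound L)
    have hL := (Nat.cast_nonneg L : (0:ℝ) ≤ L)
    exact mul_le_mul_of_nonneg_left (by linarith) (by positivity)

lemma Esig_ind_bound (xs : List X) (F₀ : X → ℤ) (T : Finset X) (hT : ∀ x ∈ xs, x ∈ T) :
    Esig xs (fun F => if F = F₀ then 1 else 0) ≤
      Real.exp (-(∑ x ∈ T, Real.log (1 + xs.count x) / 2)) := by
  refine (Esig_ind_le xs F₀ T hT).trans ?_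
  rw [← Finset.sum_neg_distrib, Real.exp_sum]
  refine Finset.prod_le_prod (fun x _ => pL_nonneg _ _) fun x _ => (pL_le _ _).trans (le_of_eq ?_)
  rw [Real.exp_neg, ← Real.log_sqrt (by positivity), Real.exp_log (by positivity)]

end Esig
end SPE

namespace SPE

/-- letters of the base walk: switch, move, switch -/
abbrev BL : Type := Bool × Bool × Bool

def stp (t : Bool) : ℤ := if t then 1 else -1

lemma av_step (f : BL → ℝ) (g : ℤ → ℝ) (h : ∀ β, f β = g (stp β.2.1)) :
    av f = (g 1 + g (-1)) / 2 := by
  rw [av_prod]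
  simp only [av_prod (A := Bool) (B := Bool), h, av_bool, stp]
  simp

/-- end point -/
def zend : ℤ → List BL → ℤ
  | z, [] => z
  | z, β :: l => zend (z + stp β.2.1) l

/-- maximal modulus -/
def Mx : ℤ → List BL → ℕ
  | z, [] => z.natAbs
  | z, β :: l => max z.natAbs (Mx (z + stp β.2.1) l)

lemma le_Mx (z : ℤ) (l : List BL) : z.natAbs ≤ Mx z l := by
  cases l <;> simp [Mx]

lemma E_zend_sq (n : ℕ) (z : ℤ) :
    EL BL n (fun l => ((zend z l : ℤ) : ℝ) ^ 2) = (z : ℝ) ^ 2 + n := by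
  induction n generalizing z with
  | zero => simp [EL_zero, zend]
  | succ n ih =>
    rw [EL_succ]
    simp only [zend, ih]
    rw [av_step _ (fun s => ((z + s : ℤ) : ℝ) ^ 2 + n) (fun β => rfl)]
    push_cast; ring

lemma doob_step (z : ℤ) (m : ℕ) (hz : z.natAbs ≤ m) :
    ((((max m (z + 1).natAbs : ℕ) : ℝ) ^ 2 - 2 * ((max m (z + 1).natAbs : ℕ) : ℝ) * |((z + 1 : ℤ) : ℝ)|)
     + (((max m (z + -1).natAbs : ℕ) : ℝ) ^ 2 - 2 * ((max m (z + -1).natAbs : ℕ) : ℝ) * |((z + -1 : ℤ) : ℝ)|)) / 2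
      ≤ (m : ℝ) ^ 2 - 2 * m * |(z : ℝ)| := by
  have key : ((((max m (z + 1).natAbs : ℕ) : ℤ) ^ 2 - 2 * ((max m (z + 1).natAbs : ℕ) : ℤ) * |z + 1|)
     + (((max m (z + -1).natAbs : ℕ) : ℤ) ^ 2 - 2 * ((max m (z + -1).natAbs : ℕ) : ℤ) * |z + -1|))
      ≤ 2 * ((m : ℤ) ^ 2 - 2 * m * |z|) := by
    rcases lt_trichotomy z 0 with h | h | h
    · rw [abs_of_neg h, abs_of_nonpos (show z + 1 ≤ 0 by omega), abs_of_neg (show z + -1 < 0 by omega)]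
      rw [max_eq_left (show (z + 1).natAbs ≤ m by omega)]
      rcases Nat.lt_or_ge z.natAbs m with h1 | h1
      · rw [max_eq_left (show (z + -1).natAbs ≤ m by omega)]; ring_nf; rfl
      · have h2 : z = - (m : ℤ) := by omega
        rw [max_eq_right (show m ≤ (z + -1).natAbs by omega)]
        have h3 : ((z + -1).natAbs : ℤ) = m + 1 := by omega
        rw [h3, h2]; ring_nf; omega
    · subst h
      rcases Nat.eq_zero_or_pos m with h1 | h1
      · subst h1; simp
      · rw [max_eq_left (show ((0:ℤ) + 1).natAbs ≤ m by omega),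
          max_eq_left (show ((0:ℤ) + -1).natAbs ≤ m by omega)]
        simp; nlinarith
    · rw [abs_of_pos h, abs_of_pos (show 0 < z + 1 by omega), abs_of_nonneg (show 0 ≤ z + -1 by omega)]
      rw [max_eq_left (show (z + -1).natAbs ≤ m by omega)]
      rcases Nat.lt_or_ge z.natAbs m with h1 | h1
      · rw [max_eq_left (show (z + 1).natAbs ≤ m by omega)]; ring_nf; rfl
      · have h2 : z = (m : ℤ) := by omega
        rw [max_eq_right (show m ≤ (z + 1).natAbs by omega)]
        have h3 : ((z + 1).natAbs : ℤ) = m + 1 := by omega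
        rw [h3, h2]; ring_nf; omega
  have key' := (Int.cast_le (R := ℝ)).mpr key
  simp only [Nat.cast_max, Nat.cast_natAbs]
  push_cast at key' ⊢
  linarith

lemma doob_aux (n : ℕ) (z : ℤ) (m : ℕ) (hz : z.natAbs ≤ m) :
    EL BL n (fun l => ((max m (Mx z l) : ℕ) : ℝ) ^ 2
      - 2 * ((max m (Mx z l) : ℕ) : ℝ) * |((zend z l : ℤ) : ℝ)|)
      ≤ (m : ℝ) ^ 2 - 2 * m * |(z : ℝ)| := by
  induction n generalizing z m with
  | zero => simp only [EL_zero, Mx, zend, max_eq_left hz]; rfl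
  | succ n ih =>
    rw [EL_succ]
    refine le_trans (av_mono (g := fun β => (fun s : ℤ => ((max m (z + s).natAbs : ℕ) : ℝ) ^ 2
      - 2 * ((max m (z + s).natAbs : ℕ) : ℝ) * |((z + s : ℤ) : ℝ)|) (stp β.2.1)) fun β => ?_) ?_
    · refine le_trans (le_of_eq ?_) (ih (z + stp β.2.1) (max m (z + stp β.2.1).natAbs) (le_max_right _ _))
      congr 1; funext l
      have : max m (Mx z (β :: l)) = max (max m (z + stp β.2.1).natAbs) (Mx (z + stp β.2.1) l) := by
        have := le_Mx (z + stp β.2.1) l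
        simp only [Mx]; omega
      rw [this]; rfl
    · rw [av_step _ (fun s : ℤ => ((max m (z + s).natAbs : ℕ) : ℝ) ^ 2
        - 2 * ((max m (z + s).natAbs : ℕ) : ℝ) * |((z + s : ℤ) : ℝ)|) (fun β => rfl)]
      exact doob_step z m hz

lemma E_Mx_sq (n : ℕ) : EL BL n (fun l => (Mx 0 l : ℝ) ^ 2) ≤ 4 * n := by
  have h1 := doob_aux n 0 0 (by simp)
  have h2 := E_zend_sq n 0
  have h3 : EL BL n (fun l => (1/2 : ℝ) * (Mx 0 l : ℝ) ^ 2 + (-2) * ((zend 0 l : ℤ) : ℝ) ^ 2) ≤ 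
    EL BL n (fun l => ((max 0 (Mx 0 l) : ℕ) : ℝ) ^ 2
      - 2 * ((max 0 (Mx 0 l) : ℕ) : ℝ) * |((zend 0 l : ℤ) : ℝ)|) := by
    refine EL_mono n fun l _ => ?_
    rw [max_eq_right (Nat.zero_le _)]
    have := sq_abs ((zend 0 l : ℤ) : ℝ)
    nlinarith [sq_nonneg ((Mx 0 l : ℝ) - 2 * |((zend 0 l : ℤ) : ℝ)|)]
  rw [EL_add, EL_mul_left, EL_mul_left, h2] at h3
  norm_num at h1 h3
  linarith

/-- weighted Green recursion -/
noncomputable def Uw (w : ℕ → ℝ) : ℕ → ℤ → ℕ → ℝ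
  | 0, z, m => if z = 0 then w m else 0
  | j + 1, z, m => (Uw w j (z - 1) m + Uw w j (z + 1) (max m (z + 1).toNat)) / 2

noncomputable def Phi (w : ℕ → ℝ) (D : ℕ) (z : ℤ) (m : ℕ) : ℝ :=
  if m < D then 2 * w m * (m + 1 - (z.toNat : ℝ)) + 2 * ∑ k ∈ Finset.Ico (m + 1) D, w k else 0

lemma Phi_nonneg (w : ℕ → ℝ) (hw : ∀ k, 0 ≤ w k) (D : ℕ) (z : ℤ) (m : ℕ) (hz : z ≤ m) :
    0 ≤ Phi w D z m := by
  unfold Phi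
  split_ifs
  · have : (z.toNat : ℝ) ≤ m := by exact_mod_cast (show z.toNat ≤ m by omega)
    have h2 : 0 ≤ ∑ k ∈ Finset.Ico (m + 1) D, w k := Finset.sum_nonneg fun k _ => hw k
    have := mul_nonneg (hw m) (show (0:ℝ) ≤ m + 1 - (z.toNat : ℝ) by linarith)
    linarith
  · exact le_rfl

lemma Phi_diag (w : ℕ → ℝ) (D m : ℕ) : Phi w D (m : ℤ) m = 2 * ∑ k ∈ Finset.Ico m D, w k := by
  unfold Phi
  split_ifs with h
  · rw [Finset.sum_eq_sum_Ico_succ_bot h]; simp; ring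
  · rw [Finset.Ico_eq_empty (by omega)]; simp

lemma Phi_step (w : ℕ → ℝ) (D : ℕ) (z : ℤ) (m : ℕ) (hz : z ≤ m) :
    (if z = 0 ∧ m < D then w m else 0) + (Phi w D (z - 1) m + Phi w D (z + 1) (max m (z + 1).toNat)) / 2
      ≤ Phi w D z m := by
  rcases lt_or_eq_of_le hz with h | h
  · rw [max_eq_left (by omega)]
    unfold Phi
    by_cases hm : m < D
    · simp only [hm, if_true, and_true]
      rcases lt_trichotomy z 0 with h0 | h0 | h0
      · have e1 : z.toNat = 0 := by omega
        have e2 : (z - 1).toNat = 0 := by omega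
        have e3 : (z + 1).toNat = 0 := by omega
        rw [e1, e2, e3, if_neg (by omega)]
        push_cast; linarith
      · subst h0; simp; linarith
      · have e1 : ((z - 1).toNat : ℝ) = z.toNat - 1 := by
          have : (z.toNat) = (z-1).toNat + 1 := by omega
          rw [this]; push_cast; ring
        have e2 : ((z + 1).toNat : ℝ) = z.toNat + 1 := by
          have : (z+1).toNat = z.toNat + 1 := by omega
          rw [this]; push_cast; ring
        rw [e1, e2, if_neg (by omega)]
        linarith
    · simp [hm]
  · subst h
    have e : max m ((m : ℤ) + 1).toNat = m + 1 := by omega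
    rw [e]
    have e2 : ((m : ℤ) + 1) = ((m + 1 : ℕ) : ℤ) := by push_cast; ring
    rw [e2, Phi_diag, Phi_diag]
    by_cases hm : m < D
    · rw [Finset.sum_eq_sum_Ico_succ_bot hm]
      unfold Phi
      rcases Nat.eq_zero_or_pos m with h0 | h0
      · subst h0; simp [hm]; linarith
      · have e1 : (((m : ℤ) - 1).toNat : ℝ) = m - 1 := by
          have : m = ((m : ℤ) -1).toNat + 1 := by omega
          conv_rhs => rw [this]
          push_cast; ring
        rw [e1, if_pos hm, if_neg (by omega)]
        linarith
    · rw [Finset.Ico_eq_empty (by omega), Finset.Ico_eq_empty (by omega)]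
      simp [Phi, hm]

lemma green_pot (w : ℕ → ℝ) (hw : ∀ k, 0 ≤ w k) (hwa : Antitone w) (D : ℕ) (c : ℝ) (hc : 0 < c)
    (n : ℕ) (z : ℤ) (m : ℕ) (hz : z ≤ m) :
    ∑ j ∈ Finset.range (n + 1), Uw w j z m ≤
      Phi w D z m + w D * ((c + ((z : ℝ) ^ 2 + n + 1) / c) / 2 - |(z : ℝ)|) := by
  have h0 : (if z = 0 then w m else 0) ≤ (if z = 0 ∧ m < D then w m else 0)
      + w D * (if z = 0 then 1 else 0) := by
    by_cases hz0 : z = 0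
    · by_cases hm : m < D
      · simp [hz0, hm, hw]
      · simp [hz0, hm]; exact hwa (by omega)
    · simp [hz0]
  induction n generalizing z m with
  | zero =>
    simp only [zero_add, Finset.sum_range_one, Uw]
    refine h0.trans (add_le_add ?_ (mul_le_mul_of_nonneg_left ?_ (hw D)))
    · have := Phi_step w D z m hz
      have h1 := Phi_nonneg w hw D (z - 1) m (by omega)
      have h2 := Phi_nonneg w hw D (z + 1) (max m (z + 1).toNat) (by omega)
      linarith
    · push_cast
      split_ifs with h
      · subst h
        have : 2 ≤ c + 1 / c := by
          rw [show c + 1 / c = (c * c + 1) / c by field_simp, le_div_iff₀ hc]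
          nlinarith [sq_nonneg (c - 1)]
        simp only [Int.cast_zero, abs_zero]
        norm_num at this ⊢
        linarith
      · have : 2 * |(z : ℝ)| ≤ c + ((z : ℝ) ^ 2 + 0 + 1) / c := by
          rw [show c + ((z : ℝ) ^ 2 + 0 + 1) / c = (c * c + ((z : ℝ) ^ 2 + 0 + 1)) / c by field_simp,
            le_div_iff₀ hc, ← sq_abs (z : ℝ)]
          nlinarith [sq_nonneg (c - |(z : ℝ)|)]
        linarith
  | succ n ih =>
    rw [Finset.sum_range_succ']
    simp only [Uw]
    rw [← Finset.sum_div, Finset.sum_add_distrib]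
    have i1 := ih (z - 1) m (by omega)
    have i2 := ih (z + 1) (max m (z + 1).toNat) (by omega)
    have hh : ∀ z : ℤ, ∀ m : ℕ, (if z = 0 then w m else 0) ≤ (if z = 0 ∧ m < D then w m else 0)
      + w D * (if z = 0 then 1 else 0) := by
      intro z m
      by_cases hz0 : z = 0
      · by_cases hm : m < D
        · simp [hz0, hm, hw]
        · simp [hz0, hm]; exact hwa (by omega)
      · simp [hz0]
    have j1 := i1 (hh _ _)
    have j2 := i2 (hh _ _)
    have hs := Phi_step w D z m hz
    have habs : |((z - 1 : ℤ) : ℝ)| + |((z + 1 : ℤ) : ℝ)| = 2 * |(z : ℝ)| + 2 * (if z = 0 then 1 else 0) := by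
      have : |z - 1| + |z + 1| = 2 * |z| + 2 * (if z = 0 then 1 else 0) := by
        split_ifs with h
        · subst h; simp
        · rcases lt_or_gt_of_ne h with h | h
          · rw [abs_of_neg h, abs_of_nonpos (show z + 1 ≤ 0 by omega), abs_of_neg (show z - 1 < 0 by omega)]
            ring
          · rw [abs_of_pos h, abs_of_pos (show 0 < z + 1 by omega), abs_of_nonneg (show 0 ≤ z - 1 by omega)]
            ring
      have := congrArg (fun x : ℤ => (x : ℝ)) this
      push_cast at this ⊢
      split_ifs at this ⊢ <;> simpa using this
    have hq : w D * ((c + ((((z - 1 : ℤ)) : ℝ) ^ 2 + n + 1) / c) / 2 - |((z - 1 : ℤ) : ℝ)|)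
       + w D * ((c + ((((z + 1 : ℤ)) : ℝ) ^ 2 + n + 1) / c) / 2 - |((z + 1 : ℤ) : ℝ)|)
       = 2 * (w D * ((c + ((z : ℝ) ^ 2 + (n + 1 : ℕ) + 1) / c) / 2 - |(z : ℝ)|))
         - 2 * (w D * (if z = 0 then 1 else 0)) := by
      have : |((z + 1 : ℤ) : ℝ)| = 2 * |(z : ℝ)| + 2 * (if z = 0 then 1 else 0) - |((z - 1 : ℤ) : ℝ)| := by
        linarith
      rw [this]; push_cast; field_simp; ring
    linarith

lemma green_pot_zero (w : ℕ → ℝ) (hw : ∀ k, 0 ≤ w k) (hwa : Antitone w) (D : ℕ) (c : ℝ) (hc : 0 < c)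
    (n : ℕ) : ∑ j ∈ Finset.range (n + 1), Uw w j 0 0 ≤
      2 * ∑ k ∈ Finset.range D, w k + w D * ((c + (n + 1) / c) / 2) := by
  have := green_pot w hw hwa D c hc n 0 0 (by simp)
  have h2 := Phi_diag w D 0
  simp only [Nat.cast_zero, Nat.Ico_zero_eq_range] at h2
  rw [h2] at this
  simpa using this
end SPE

namespace SPE

/-- the lamplighter group over `ℤ` with (unrestricted) `ℤ/2` lamps -/
@[ext] structure Lm where
  φ : ℤ → ZMod 2
  z : ℤ

namespace Lm
instance : Mul Lm := ⟨fun a b => ⟨fun i => a.φ i + b.φ (i - a.z), a.z + b.z⟩⟩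
instance : One Lm := ⟨⟨0, 0⟩⟩
instance : Inv Lm := ⟨fun a => ⟨fun i => - a.φ (i + a.z), - a.z⟩⟩
@[simp] lemma mul_φ (a b : Lm) (i : ℤ) : (a * b).φ i = a.φ i + b.φ (i - a.z) := rfl
@[simp] lemma mul_z (a b : Lm) : (a * b).z = a.z + b.z := rfl
@[simp] lemma one_φ (i : ℤ) : (1 : Lm).φ i = 0 := rfl
@[simp] lemma one_z : (1 : Lm).z = 0 := rfl
@[simp] lemma inv_φ (a : Lm) (i : ℤ) : (a⁻¹).φ i = - a.φ (i + a.z) := rfl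
@[simp] lemma inv_z (a : Lm) : (a⁻¹).z = - a.z := rfl
instance : Group Lm := Group.ofLeftAxioms
  (fun a b c => by
    ext i
    · simp [add_assoc, sub_sub]
    · simp [add_assoc])
  (fun a => by ext i <;> simp)
  (fun a => by
    ext i
    · simp only [mul_φ, inv_φ, inv_z, one_φ, sub_neg_eq_add, neg_add_cancel]
    · simp)
end Lm

/-- the space acted upon: position and the lamps at the marked offsets -/
@[ext] structure XS (m : ℤ → ZMod 2) where
  u : ℤ
  ψ : ℤ → ZMod 2

namespace XS
variable {m : ℤ → ZMod 2}
instance : SMul Lm (XS m) := ⟨fun g x => ⟨x.u + g.z, fun s => x.ψ s + m s * g.φ (x.u + g.z + s)⟩⟩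
@[simp] lemma smul_u (g : Lm) (x : XS m) : (g • x).u = x.u + g.z := rfl
@[simp] lemma smul_ψ (g : Lm) (x : XS m) (s : ℤ) :
  (g • x).ψ s = x.ψ s + m s * g.φ (x.u + g.z + s) := rfl
instance : MulAction Lm (XS m) where
  one_smul x := by ext i <;> simp
  mul_smul a b x := by
    ext i
    · simp; ring
    · simp only [smul_ψ, Lm.mul_φ, Lm.mul_z, smul_u]
      rw [show x.u + (a.z + b.z) + i - a.z = x.u + b.z + i by ring,
        show x.u + (a.z + b.z) + i = x.u + b.z + a.z + i by ring]
      ring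
/-- base point -/
def o : XS m := ⟨0, 0⟩
@[simp] lemma o_u : (o : XS m).u = 0 := rfl
@[simp] lemma o_ψ (s : ℤ) : (o : XS m).ψ s = 0 := rfl
end XS

/-- permutational wreath product with unrestricted `ℤ` lamps -/
@[ext] structure PW (m : ℤ → ZMod 2) where
  F : XS m → ℤ
  g : Lm

namespace PW
variable {m : ℤ → ZMod 2}
instance : Mul (PW m) := ⟨fun a b => ⟨fun x => a.F x + b.F (a.g⁻¹ • x), a.g * b.g⟩⟩
instance : One (PW m) := ⟨⟨0, 1⟩⟩
instance : Inv (PW m) := ⟨fun a => ⟨fun x => - a.F (a.g • x), a.g⁻¹⟩⟩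
@[simp] lemma mul_F (a b : PW m) (x) : (a * b).F x = a.F x + b.F (a.g⁻¹ • x) := rfl
@[simp] lemma mul_g (a b : PW m) : (a * b).g = a.g * b.g := rfl
@[simp] lemma one_F (x) : (1 : PW m).F x = 0 := rfl
@[simp] lemma one_g : (1 : PW m).g = 1 := rfl
@[simp] lemma inv_F (a : PW m) (x) : (a⁻¹).F x = - a.F (a.g • x) := rfl
@[simp] lemma inv_g (a : PW m) : (a⁻¹).g = a.g⁻¹ := rfl
instance : Group (PW m) := Group.ofLeftAxioms
  (fun a b c => by
    ext i
    · simp only [mul_F, mul_g, mul_inv_rev, mul_smul]; ring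
    · exact congrArg (fun g : Lm => g.φ _) (mul_assoc a.g b.g c.g)
    · exact congrArg (fun g : Lm => g.z) (mul_assoc a.g b.g c.g))
  (fun a => by ext i <;> simp)
  (fun a => by
    ext i
    · simp
    · simp
    · simp)
end PW

/-- lamp letter, move letter, base letter -/
def al (x : Bool) : Lm := ⟨Pi.single 0 (x.toNat : ZMod 2), 0⟩
def tl (t : Bool) : Lm := ⟨0, stp t⟩
def bl (β : BL) : Lm := al β.1 * tl β.2.1 * al β.2.2

lemma bl_z (β : BL) : (bl β).z = stp β.2.1 := by simp [bl, al, tl]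
lemma bl_φ (β : BL) (i : ℤ) : (bl β).φ i =
    (if i = 0 then (β.1.toNat : ZMod 2) else 0) + (if i = stp β.2.1 then (β.2.2.toNat : ZMod 2) else 0) := by
  simp [bl, al, tl, Pi.single_apply, sub_eq_zero]

/-- base word -/
def bw (l : List BL) : Lm := (l.map bl).prod
@[simp] lemma bw_nil : bw [] = 1 := rfl
@[simp] lemma bw_cons (β : BL) (l : List BL) : bw (β :: l) = bl β * bw l := by simp [bw]

section
variable (m : ℤ → ZMod 2)

/-- sites of the successive switches -/
def sites : List BL → List (XS m)
  | [] => []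
  | β :: l => XS.o :: (XS.o :: sites l).map (fun x => bl β • x)

abbrev SL : Type := (Bool × Bool) × BL × (Bool × Bool)

noncomputable def bp (k : ℤ) : PW m := ⟨Pi.single XS.o k, 1⟩
def inj (g : Lm) : PW m := ⟨0, g⟩
noncomputable def sl (a : SL) : PW m := bp m (ev a.1) * inj m (bl a.2.1) * bp m (ev a.2.2)

noncomputable def sw (l : List SL) : PW m := (l.map (sl m)).prod
def bs (l : List SL) : List BL := l.map (fun a => a.2.1)

@[simp] lemma sw_nil : sw m [] = 1 := rfl
@[simp] lemma sw_cons (a : SL) (l : List SL) : sw m (a :: l) = sl m a * sw m l := by simp [sw]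
@[simp] lemma bs_nil : bs [] = [] := rfl
@[simp] lemma bs_cons (a : SL) (l : List SL) : bs (a :: l) = a.2.1 :: bs l := rfl
lemma bs_length (l : List SL) : (bs l).length = l.length := by simp [bs]

lemma sw_g (l : List SL) : (sw m l).g = bw (bs l) := by
  induction l with
  | nil => rfl
  | cons a l ih => simp [sl, ih, bp, inj]

lemma sw_F_cons (a : SL) (l : List SL) : (sw m (a :: l)).F =
    Pi.single XS.o (ev a.1) + (Pi.single XS.o (ev a.2.2) + (sw m l).F) ∘ (fun x => (bl a.2.1)⁻¹ • x) := by
  funext x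
  simp [sl, bp, inj, add_assoc]

lemma split (n : ℕ) (U : (XS m → ℤ) → List BL → ℝ) :
    EL SL n (fun l => U (sw m l).F (bs l)) = EL BL n (fun l => Esig (sites m l) (fun F => U F l)) := by
  induction n generalizing U with
  | zero => rfl
  | succ n ih =>
    simp only [EL_succ]
    rw [av_prod]
    simp only [av_prod (A := BL) (B := Bool × Bool)]
    rw [av_comm]
    congr 1; funext β
    have h1 : ∀ e1 e2 : Bool × Bool, EL SL n (fun l => U (sw m ((e1, β, e2) :: l)).F (bs ((e1, β, e2) :: l)))
       = EL BL n (fun l => Esig (sites m l) (fun F => U (Pi.single XS.o (ev e1) +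
          (Pi.single XS.o (ev e2) + F) ∘ (fun x => (bl β)⁻¹ • x)) (β :: l))) := by
      intro e1 e2
      have hh := ih (fun F l => U (Pi.single XS.o (ev e1) +
          (Pi.single XS.o (ev e2) + F) ∘ (fun x => (bl β)⁻¹ • x)) (β :: l))
      refine Eq.trans ?_ hh
      congr 1; funext l
      rw [sw_F_cons]; rfl
    simp only [h1]
    simp only [← EL_av]
    congr 1; funext l
    simp only [sites]
    rw [Esig_cons]
    congr 1; funext e1
    have := Esig_map (MulAction.toPerm (bl β) : Equiv.Perm (XS m)) (XS.o :: sites m l)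
      (fun F => U (Pi.single XS.o (ev e1) + F) (β :: l))
    have e : (fun x => bl β • x) = ⇑(MulAction.toPerm (bl β) : Equiv.Perm (XS m)) := rfl
    rw [e, this, Esig_cons]
    rfl

lemma sites_length (l : List BL) : (sites m l).length = 2 * l.length := by
  induction l with
  | nil => rfl
  | cons β l ih => simp [sites, ih]; ring

/-- number of coincidences -/
noncomputable def npr {X : Type} : List X → ℕ
  | [] => 0
  | x :: xs => npr xs + 2 * xs.count x + 1

lemma npr_map {X : Type} (f : X → X) (hf : Function.Injective f) (xs : List X) :
    npr (xs.map f) = npr xs := by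
  induction xs with
  | nil => rfl
  | cons x xs ih => simp [npr, ih, List.count_map_of_injective _ _ hf]

lemma sum_count {X : Type} (xs : List X) (T : Finset X) (hT : ∀ x ∈ xs, x ∈ T) :
    ∑ x ∈ T, xs.count x = xs.length := by
  induction xs with
  | nil => simp
  | cons y xs ih =>
    have : ∀ x ∈ T, (y :: xs).count x = xs.count x + if y = x then 1 else 0 := by
      intro x _; simp [List.count_cons]
    rw [Finset.sum_congr rfl this, Finset.sum_add_distrib, ih (fun x hx => hT x (by simp [hx]))]
    simp [hT y (by simp)]

lemma sum_count_sq {X : Type} (xs : List X) (T : Finset X) (hT : ∀ x ∈ xs, x ∈ T) :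
    ∑ x ∈ T, xs.count x ^ 2 = npr xs := by
  induction xs with
  | nil => simp [npr]
  | cons y xs ih =>
    have : ∀ x ∈ T, (y :: xs).count x ^ 2 = xs.count x ^ 2 + if y = x then 2 * xs.count x + 1 else 0 := by
      intro x _; by_cases h : y = x
      · simp [List.count_cons, h]; ring
      · simp [List.count_cons, h]
    rw [Finset.sum_congr rfl this, Finset.sum_add_distrib, ih (fun x hx => hT x (by simp [hx]))]
    simp [hT y (by simp), npr, add_assoc]

lemma npr_sites (β : BL) (l : List BL) : npr (sites m (β :: l)) =
    npr (sites m l) + 2 * (sites m l).count XS.o + 2 * (sites m (β :: l)).count XS.o := by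
  have h : npr ((XS.o :: sites m l).map (fun x => bl β • x)) = npr (XS.o :: sites m l) :=
    npr_map _ (MulAction.injective (bl β)) _
  simp only [sites, npr] at h ⊢
  rw [h, List.count_cons_self]
  ring

/-- return probabilities -/
noncomputable def pr (j : ℕ) (γ : Lm) : ℝ :=
  EL BL j (fun l => if (γ * bw l) • (XS.o : XS m) = XS.o then 1 else 0)

lemma pr_succ (j : ℕ) (γ : Lm) : pr m (j + 1) γ = av fun β => pr m j (γ * bl β) := by
  simp only [pr, EL_succ, bw_cons, mul_assoc]

lemma count_sites (n : ℕ) (γ : Lm) :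
    EL BL n (fun l => (((sites m l).map (fun x => γ • x)).count XS.o : ℝ)) =
      ∑ j ∈ Finset.range n, (pr m j γ + pr m (j + 1) γ) := by
  induction n generalizing γ with
  | zero => simp [EL_zero, sites]
  | succ n ih =>
    rw [EL_succ, Finset.sum_range_succ']
    have : ∀ β : BL, EL BL n (fun l => (((sites m (β :: l)).map (fun x => γ • x)).count XS.o : ℝ)) =
        ∑ j ∈ Finset.range n, (pr m j (γ * bl β) + pr m (j + 1) (γ * bl β)) +
          (pr m 0 γ + pr m 0 (γ * bl β)) := by
      intro β
      rw [← ih (γ * bl β), ← EL_const (A := BL) n (pr m 0 γ + pr m 0 (γ * bl β)), ← EL_add]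
      congr 1; funext l
      simp only [sites, List.map_cons, List.map_map, List.count_cons, pr, EL_zero, bw_nil, mul_one]
      have : ((fun x : XS m => γ • x) ∘ fun x => bl β • x) = fun x => (γ * bl β) • x := by
        funext x; simp [mul_smul]
      rw [this]
      simp [mul_smul]; ring
    simp only [this, av_add, av_sum, av_const, ← pr_succ]

lemma E_npr_le (n : ℕ) : EL BL n (fun l => (npr (sites m l) : ℝ)) ≤
    8 * n * ∑ j ∈ Finset.range (n + 1), pr m j 1 := by
  have hp : ∀ j, 0 ≤ pr m j 1 := fun j => by
    have := EL_mono (A := BL) j (f := fun _ => 0)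
      (g := (fun l => if ((1 : Lm) * bw l) • (XS.o : XS m) = XS.o then 1 else 0))
      (fun l _ => by positivity)
    rwa [EL_const] at this
  have hc : ∀ k, EL BL k (fun l => ((sites m l).count XS.o : ℝ)) ≤
      2 * ∑ j ∈ Finset.range (k + 1), pr m j 1 := by
    intro k
    have := count_sites m k 1
    simp only [one_smul, List.map_id'] at this
    rw [this, Finset.sum_add_distrib]
    have h1 : ∑ j ∈ Finset.range k, pr m j 1 ≤ ∑ j ∈ Finset.range (k + 1), pr m j 1 := by
      rw [Finset.sum_range_succ]; linarith [hp k]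
    have h2 : ∑ j ∈ Finset.range k, pr m (j + 1) 1 ≤ ∑ j ∈ Finset.range (k + 1), pr m j 1 := by
      rw [Finset.sum_range_succ']; linarith [hp 0]
    linarith
  induction n with
  | zero => simp [EL_zero, sites, npr]
  | succ n ih =>
    have h1 : EL BL (n + 1) (fun l => (npr (sites m l) : ℝ)) =
        EL BL n (fun l => (npr (sites m l) : ℝ)) + 2 * EL BL n (fun l => ((sites m l).count XS.o : ℝ))
          + 2 * EL BL (n + 1) (fun l => ((sites m l).count XS.o : ℝ)) := by
      simp only [EL_succ, npr_sites]
      push_cast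
      simp only [EL_add, EL_mul_left, av_add, av_mul_left, av_const]
    rw [h1]
    have h2 := hc n
    have h3 := hc (n + 1)
    have h4 : ∑ j ∈ Finset.range (n + 1), pr m j 1 ≤ ∑ j ∈ Finset.range (n + 1 + 1), pr m j 1 := by
      rw [Finset.sum_range_succ _ (n+1)]; linarith [hp (n+1)]
    have h5 : 8 * (n:ℝ) * ∑ j ∈ Finset.range (n + 1), pr m j 1 ≤
       8 * (n:ℝ) * ∑ j ∈ Finset.range (n + 1 + 1), pr m j 1 := by gcongr
    push_cast
    linarith

/-- number of marked offsets up to `d` -/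
noncomputable def kap (d : ℕ) : ℕ := ((Finset.Icc 1 d).filter (fun s : ℕ => m s = 1)).card

lemma kap_succ (d : ℕ) : kap m (d + 1) = kap m d + if m ((d + 1 : ℕ) : ℤ) = 1 then 1 else 0 := by
  unfold kap
  rw [← Finset.insert_Icc_right_eq_Icc_add_one (by omega), Finset.filter_insert]
  split_ifs with h
  · rw [Finset.card_insert_of_notMem (by simp)]
  · rfl

noncomputable def ww (d : ℕ) : ℝ := (1 / 2) ^ kap m d

lemma ww_succ (d : ℕ) : ww m (d + 1) = ww m d * if m ((d + 1 : ℕ) : ℤ) = 1 then 1 / 2 else 1 := by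
  unfold ww; rw [kap_succ]; split_ifs
  · rw [pow_succ]
  · simp

/-- the indicator in the return estimate -/
def Cnd (z : ℤ) (k : ℕ) (ψ : ℤ → ZMod 2) (γ : Lm) : Prop :=
  z + γ.z = 0 ∧ ∀ s : ℤ, (k : ℤ) < s → m s = 1 → γ.φ (s - z) = ψ s

lemma cnd_easy (z : ℤ) (k : ℕ) (hz : z ≤ k) (ψ : ℤ → ZMod 2) (β : BL) (γ : Lm) (h : z + stp β.2.1 ≤ k)
    (hc : Cnd m z k ψ (bl β * γ)) : Cnd m (z + stp β.2.1) k ψ γ := by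
  refine ⟨by rw [← hc.1]; simp [bl_z]; ring, fun s hs hm => ?_⟩
  have := hc.2 s hs hm
  rw [Lm.mul_φ, bl_φ, bl_z, if_neg (by omega), if_neg (by omega)] at this
  rw [← this]; simp; congr 1; ring

lemma cnd_drop (z : ℤ) (k : ℕ) (hz : z ≤ k) (ψ : ℤ → ZMod 2) (β : BL) (γ : Lm) (h : z + stp β.2.1 ≤ k + 1)
    (hc : Cnd m z k ψ (bl β * γ)) : Cnd m (z + stp β.2.1) (k + 1) ψ γ := by
  refine ⟨by rw [← hc.1]; simp [bl_z]; ring, fun s hs hm => ?_⟩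
  push_cast at hs
  have := hc.2 s (by omega) hm
  rw [Lm.mul_φ, bl_φ, bl_z, if_neg (by omega), if_neg (by omega)] at this
  rw [← this]; simp; congr 1; ring

lemma ret_le (j : ℕ) (z : ℤ) (k : ℕ) (hz : z ≤ k) (ψ : ℤ → ZMod 2) :
    ww m k * EL BL j (fun l => if Cnd m z k ψ (bw l) then 1 else 0) ≤ Uw (ww m) j z k := by
  have hw : ∀ k, 0 ≤ ww m k := fun k => by unfold ww; positivity
  induction j generalizing z k with
  | zero =>
    simp only [EL_zero, Uw]
    by_cases h : z = 0
    · rw [if_pos h]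
      have : (if Cnd m z k ψ (bw []) then (1:ℝ) else 0) ≤ 1 := by split_ifs <;> norm_num
      nlinarith [hw k]
    · rw [if_neg h, if_neg]
      · simp
      · intro hc; exact h (by simpa using hc.1)
  | succ j ih =>
    rw [EL_succ, av_prod]
    have hind : ∀ P Q : Prop, (P → Q) → (if P then (1:ℝ) else 0) ≤ if Q then 1 else 0 := by
      intro P Q h; by_cases hp : P
      · simp [hp, h hp]
      · simp only [hp, if_false]; split_ifs <;> norm_num
    have hx : ∀ x : Bool, ww m k * av (fun b : Bool × Bool => EL BL j (fun l => if Cnd m z k ψ (bw ((x, b) :: l)) then (1:ℝ) else 0))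
        ≤ Uw (ww m) (j + 1) z k := by
      intro x
      rw [av_prod, av_bool]
      have hF : ww m k * av (fun y : Bool => EL BL j (fun l => if Cnd m z k ψ (bw ((x, false, y) :: l)) then (1:ℝ) else 0))
          ≤ Uw (ww m) j (z - 1) k := by
        refine le_trans (mul_le_mul_of_nonneg_left ?_ (hw k)) (ih (z - 1) k (by omega))
        rw [← av_const (A := Bool) (EL BL j (fun l => if Cnd m (z - 1) k ψ (bw l) then (1:ℝ) else 0))]
        refine av_mono fun y => EL_mono j fun l _ => hind _ _ fun hc => ?_
        rw [bw_cons] at hc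
        exact cnd_easy m z k hz ψ (x, false, y) _ (by simp [stp]; omega) hc
      have hT : ww m k * av (fun y : Bool => EL BL j (fun l => if Cnd m z k ψ (bw ((x, true, y) :: l)) then (1:ℝ) else 0))
          ≤ Uw (ww m) j (z + 1) (max k (z + 1).toNat) := by
        rcases lt_or_eq_of_le hz with h | h
        · rw [max_eq_left (by omega)]
          refine le_trans (mul_le_mul_of_nonneg_left ?_ (hw k)) (ih (z + 1) k (by omega))
          rw [← av_const (A := Bool) (EL BL j (fun l => if Cnd m (z + 1) k ψ (bw l) then (1:ℝ) else 0))]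
          refine av_mono fun y => EL_mono j fun l _ => hind _ _ fun hc => ?_
          rw [bw_cons] at hc
          exact cnd_easy m z k hz ψ (x, true, y) _ (by simp [stp]; omega) hc
        · have e : max k (z + 1).toNat = k + 1 := by omega
          rw [e]
          refine le_trans ?_ (ih (z + 1) (k + 1) (by push_cast; omega))
          rw [ww_succ, mul_assoc]
          refine mul_le_mul_of_nonneg_left ?_ (hw k)
          rw [← EL_av, ← EL_mul_left]
          refine EL_mono j fun l _ => ?_
          have hd : ∀ y, Cnd m z k ψ (bw ((x, true, y) :: l)) → Cnd m (z + 1) (k + 1) ψ (bw l) := by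
            intro y hc
            rw [bw_cons] at hc
            exact cnd_drop m z k hz ψ (x, true, y) _ (by simp [stp]; omega) hc
          split_ifs with hm hc hc
          · rw [av_bool]
            have : ¬ (Cnd m z k ψ (bw ((x, true, true) :: l)) ∧ Cnd m z k ψ (bw ((x, true, false) :: l))) := by
              rintro ⟨h1, h2⟩
              have a1 := h1.2 ((k + 1 : ℕ) : ℤ) (by push_cast; omega) hm
              have a2 := h2.2 ((k + 1 : ℕ) : ℤ) (by push_cast; omega) hm
              rw [bw_cons, Lm.mul_φ, bl_φ, bl_z, if_neg (by push_cast; omega), if_pos (by simp [stp]; omega)] at a1 a2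
              rw [← a2] at a1
              simp at a1
            by_cases h1 : Cnd m z k ψ (bw ((x, true, true) :: l))
            · have h2 : ¬ Cnd m z k ψ (bw ((x, true, false) :: l)) := fun h2 => this ⟨h1, h2⟩
              simp only [h1, h2, if_true, if_false]; norm_num
            · simp only [h1, if_false]; split_ifs <;> norm_num
          · have h1 : ∀ y, ¬ Cnd m z k ψ (bw ((x, true, y) :: l)) := fun y hy => hc (hd y hy)
            simp only [h1, if_false, av_const]; norm_num
          · rw [one_mul]
            refine (av_mono (g := fun _ : Bool => (1:ℝ)) fun y => ?_).trans (by rw [av_const])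
            split_ifs <;> norm_num
          · have h1 : ∀ y, ¬ Cnd m z k ψ (bw ((x, true, y) :: l)) := fun y hy => hc (hd y hy)
            simp only [h1, if_false, av_const]; norm_num
      rw [Uw]
      linarith
    rw [← av_mul_left]
    exact (av_mono hx).trans (by rw [av_const])

lemma pr_le (j : ℕ) : pr m j 1 ≤ Uw (ww m) j 0 0 := by
  have := ret_le m j 0 0 (by simp) 0
  have h0 : ww m 0 = 1 := by simp [ww, kap]
  rw [h0, one_mul] at this
  refine le_trans (EL_mono j fun l _ => ?_) this
  rw [one_mul]
  by_cases h : bw l • (XS.o : XS m) = XS.o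
  · rw [if_pos h, if_pos]
    have hz : (bw l).z = 0 := by simpa using congrArg XS.u h
    refine ⟨by simp [hz], fun s hs hm => ?_⟩
    have := congrFun (congrArg XS.ψ h) s
    simpa [hz, hm] using this
  · rw [if_neg h]; split_ifs <;> norm_num

lemma E_npr (n D : ℕ) (c : ℝ) (hc : 0 < c) : EL BL n (fun l => (npr (sites m l) : ℝ)) ≤
    8 * n * (2 * ∑ k ∈ Finset.range D, ww m k + ww m D * ((c + (n + 1) / c) / 2)) := by
  refine (E_npr_le m n).trans (mul_le_mul_of_nonneg_left ?_ (by positivity))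
  refine (Finset.sum_le_sum fun j _ => pr_le m j).trans ?_
  refine green_pot_zero _ (fun k => by unfold ww; positivity) (antitone_nat_of_succ_le fun k => ?_) D c hc n
  rw [ww_succ]
  have : 0 ≤ ww m k := by unfold ww; positivity
  split_ifs <;> linarith
end
end SPE

namespace SPE

/-- lamp and position bounded by `M` -/
def Inn (M : ℕ) (γ : Lm) : Prop := γ.z.natAbs ≤ M ∧ ∀ i : ℤ, M < i.natAbs → γ.φ i = 0

/-- extension by zero of a finite lamp configuration -/
noncomputable def ex {M : ℕ} (θ : Finset.Icc (-(M:ℤ)) M → ZMod 2) (i : ℤ) : ZMod 2 :=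
  if h : i ∈ Finset.Icc (-(M:ℤ)) M then θ ⟨i, h⟩ else 0

lemma ex_out {M : ℕ} (θ : Finset.Icc (-(M:ℤ)) M → ZMod 2) (i : ℤ) (h : M < i.natAbs) : ex θ i = 0 := by
  rw [ex, dif_neg]; simp only [Finset.mem_Icc]; omega

lemma ex_surj {M : ℕ} (φ : ℤ → ZMod 2) (h : ∀ i : ℤ, M < i.natAbs → φ i = 0) :
    ex (fun i : Finset.Icc (-(M:ℤ)) M => φ i) = φ := by
  funext i
  unfold ex
  split_ifs with h'
  · rfl
  · rw [h]; simp only [Finset.mem_Icc] at h'; omega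

lemma ex_add {M : ℕ} (θ θ' : Finset.Icc (-(M:ℤ)) M → ZMod 2) (i : ℤ) : ex (θ + θ') i = ex θ i + ex θ' i := by
  unfold ex; split_ifs <;> simp

section
variable (m : ℤ → ZMod 2)

/-- the box of reachable sites -/
noncomputable def Box (M : ℕ) : Finset (XS m) :=
  (Finset.Icc (-(M:ℤ)) M ×ˢ (Finset.univ : Finset (Finset.Icc (-(M:ℤ)) M → ZMod 2))).image
    (fun p => (⟨ex p.2, p.1⟩ : Lm) • (XS.o : XS m))

variable {m}
lemma mem_Box {M : ℕ} {γ : Lm} (h : Inn M γ) : γ • (XS.o : XS m) ∈ Box m M := by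
  unfold Box
  rw [Finset.mem_image]
  refine ⟨(γ.z, fun i => γ.φ i), ?_, ?_⟩
  · have := h.1
    simp only [Finset.mem_product, Finset.mem_Icc, Finset.mem_univ, and_true]; omega
  · simp only [ex_surj γ.φ h.2]

lemma Box_spec {M : ℕ} {x : XS m} (h : x ∈ Box m M) :
    ∃ θ : Finset.Icc (-(M:ℤ)) M → ZMod 2, x.u.natAbs ≤ M ∧ ∀ s, x.ψ s = m s * ex θ (x.u + s) := by
  unfold Box at h
  rw [Finset.mem_image] at h
  obtain ⟨⟨u, θ⟩, h1, rfl⟩ := h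
  refine ⟨θ, ?_, ?_⟩
  · simp only [Finset.mem_product, Finset.mem_Icc, Finset.mem_univ, and_true] at h1
    simp; omega
  · intro s; simp

/-- the pattern seen from `u` -/
noncomputable def pat (m : ℤ → ZMod 2) {M : ℕ} (u : ℤ) (θ : Finset.Icc (-(M:ℤ)) M → ZMod 2) : ℤ → ZMod 2 :=
  fun s => m s * ex θ (u + s)

lemma pat_zero (hm : ∀ s ≤ 0, m s = 0) {M : ℕ} {u : ℤ} (hu : u.natAbs ≤ M)
    (θ : Finset.Icc (-(M:ℤ)) M → ZMod 2) (s : ℤ)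
    (hs : ∀ k : ℕ, k ∈ (Finset.Icc 1 (2 * M)).filter (fun s : ℕ => m s = 1) → (k : ℤ) ≠ s) : pat m u θ s = 0 := by
  unfold pat
  by_cases h0 : s ≤ 0
  · rw [hm s h0, zero_mul]
  by_cases h1 : (2 * M : ℤ) < s
  · rw [ex_out, mul_zero]; omega
  have := hs s.toNat
  rw [Finset.mem_filter, Finset.mem_Icc, Int.toNat_of_nonneg (by omega)] at this
  have h2 : m s ≠ 1 := fun h => this ⟨by omega, h⟩ rfl
  have : ∀ a : ZMod 2, a ≠ 1 → a = 0 := by decide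
  rw [this _ h2, zero_mul]

lemma pat_card (hm : ∀ s ≤ 0, m s = 0) {M : ℕ} {u : ℤ} (hu : u.natAbs ≤ M) :
    ((Finset.univ : Finset (Finset.Icc (-(M:ℤ)) M → ZMod 2)).image (pat m u)).card ≤ 2 ^ kap m (2 * M) := by
  set K := (Finset.Icc 1 (2 * M)).filter (fun s : ℕ => m s = 1) with hK
  have : (Finset.univ : Finset (K → ZMod 2)).card = 2 ^ kap m (2 * M) := by
    rw [Finset.card_univ, Fintype.card_fun, ZMod.card, Fintype.card_coe]; rfl
  rw [← this]
  refine Finset.card_le_card_of_injOn (fun ψ k => ψ ((k : ℕ) : ℤ)) (fun _ _ => Finset.mem_coe.2 (Finset.mem_univ _)) ?_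
  intro a ha b hb hab
  simp only [Finset.coe_image, Set.mem_image, Finset.coe_univ, Set.mem_univ, true_and] at ha hb
  obtain ⟨θ, rfl⟩ := ha
  obtain ⟨θ', rfl⟩ := hb
  funext s
  by_cases hs : ∃ k ∈ K, (k : ℤ) = s
  · obtain ⟨k, hk, rfl⟩ := hs
    exact congrFun hab ⟨k, hk⟩
  · push Not at hs
    rw [pat_zero hm hu θ s hs, pat_zero hm hu θ' s hs]

lemma Box_card (hm : ∀ s ≤ 0, m s = 0) (M : ℕ) : (Box m M).card ≤ (2 * M + 1) * 2 ^ kap m (2 * M) := by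
  have h1 : Box m M ⊆ (Finset.Icc (-(M:ℤ)) M).biUnion (fun u =>
      ((Finset.univ : Finset (Finset.Icc (-(M:ℤ)) M → ZMod 2)).image (pat m u)).image (fun ψ => (⟨u, ψ⟩ : XS m))) := by
    intro x hx
    obtain ⟨θ, hu, hψ⟩ := Box_spec hx
    rw [Finset.mem_biUnion]
    refine ⟨x.u, by rw [Finset.mem_Icc]; omega, ?_⟩
    rw [Finset.mem_image]
    refine ⟨pat m x.u θ, Finset.mem_image_of_mem _ (Finset.mem_univ _), ?_⟩
    ext s
    · rfl
    · exact (hψ s).symm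
  refine (Finset.card_le_card h1).trans ?_
  have h2 : (Finset.Icc (-(M:ℤ)) M).card = 2 * M + 1 := by rw [Int.card_Icc]; omega
  rw [← h2]
  refine Finset.card_biUnion_le_card_mul _ _ _ fun u hu => ?_
  refine Finset.card_image_le.trans (pat_card hm ?_)
  rw [Finset.mem_Icc] at hu; omega

/-- each site of the box is covered by many configurations -/
lemma cover_frac (hm : ∀ s ≤ 0, m s = 0) {M : ℕ} {x : XS m} (hx : x ∈ Box m M) :
    (Finset.univ : Finset (Finset.Icc (-(M:ℤ)) M → ZMod 2)).card ≤
      2 ^ kap m (2 * M) * ((Finset.univ : Finset (Finset.Icc (-(M:ℤ)) M → ZMod 2)).filter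
        (fun θ => pat m x.u θ = x.ψ)).card := by
  obtain ⟨θ₀, hu, hψ⟩ := Box_spec hx
  have hx0 : pat m x.u θ₀ = x.ψ := by funext s; exact (hψ s).symm
  refine le_trans (Finset.card_le_mul_card_image (f := pat m x.u) _
    ((Finset.univ : Finset (Finset.Icc (-(M:ℤ)) M → ZMod 2)).filter (fun θ => pat m x.u θ = x.ψ)).card ?_) ?_
  · intro ψ hp
    rw [Finset.mem_image] at hp
    obtain ⟨θ₁, -, rfl⟩ := hp
    refine Finset.card_le_card_of_injOn (fun θ => θ - θ₁ + θ₀) ?_ ?_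
    · intro θ hθ
      simp only [Finset.coe_filter, Finset.mem_univ, true_and, Set.mem_setOf_eq] at hθ ⊢
      rw [← hx0]
      funext s
      have h1 := congrFun hθ s
      have h2 : ex θ (x.u + s) = ex (θ - θ₁) (x.u + s) + ex θ₁ (x.u + s) := by rw [← ex_add]; simp
      unfold pat at h1 ⊢
      rw [ex_add, mul_add]
      rw [h2, mul_add] at h1
      rw [add_eq_right] at h1
      rw [h1, zero_add]
    · intro a _ b _ hab
      simpa using hab
  · rw [mul_comm]
    exact Nat.mul_le_mul_right _ (pat_card hm hu)

lemma sites_In (l : List BL) (M : ℕ) (γ : Lm) (h : Inn M γ) (hM : Mx γ.z l ≤ M) :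
    (∀ x ∈ sites m l, γ • x ∈ Box m M) ∧ Inn M (γ * bw l) := by
  induction l generalizing γ with
  | nil => exact ⟨by simp [sites], by simpa using h⟩
  | cons β l ih =>
    simp only [Mx, max_le_iff] at hM
    have h1 := le_Mx (γ.z + stp β.2.1) l
    have h2 : Inn M (γ * bl β) := by
      refine ⟨by rw [Lm.mul_z, bl_z]; omega, fun i hi => ?_⟩
      rw [Lm.mul_φ, h.2 i hi, bl_φ, if_neg (by omega), if_neg (by omega)]; simp
    obtain ⟨h3, h4⟩ := ih (γ * bl β) h2 (by rw [Lm.mul_z, bl_z]; exact hM.2)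
    refine ⟨?_, by rwa [bw_cons, ← mul_assoc]⟩
    intro x hx
    simp only [sites, List.map_cons, List.mem_cons, List.mem_map] at hx
    rcases hx with rfl | rfl | ⟨y, hy, rfl⟩
    · exact mem_Box h
    · rw [← mul_smul]; exact mem_Box h2
    · rw [← mul_smul]; exact h3 y hy

lemma sites_Box (l : List BL) : ∀ x ∈ sites m l, x ∈ Box m (Mx 0 l) := by
  have := (sites_In (m := m) l (Mx 0 l) 1 ⟨by simp, fun _ _ => rfl⟩ le_rfl).1
  simpa using this

lemma bw_In (l : List BL) : Inn (Mx 0 l) (bw l) := by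
  have := (sites_In (m := 0) l (Mx 0 l) 1 ⟨by simp, fun _ _ => rfl⟩ le_rfl).2
  simpa using this

lemma ev_abs (e : Bool × Bool) : |ev e| ≤ 1 := by
  rcases e with ⟨_ | _, _ | _⟩ <;> simp [ev]

lemma F_le_count (l : List SL) (x : XS m) : |(sw m l).F x| ≤ (sites m (bs l)).count x := by
  induction l generalizing x with
  | nil => simp [sites]
  | cons a l ih =>
    rw [sw_F_cons]
    have hs : ∀ (y : XS m) (e : Bool × Bool), |(Pi.single XS.o (ev e) : XS m → ℤ) y| ≤ if XS.o = y then 1 else 0 := by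
      intro y e
      rw [Pi.single_apply]
      split_ifs with h1 h2 h2
      · exact ev_abs e
      · exact absurd h1.symm h2
      · exact absurd h2.symm h1
      · simp
    have hc : (sites m (bs (a :: l))).count x = (if XS.o = x then 1 else 0) +
        ((if XS.o = (bl a.2.1)⁻¹ • x then 1 else 0) + (sites m (bs l)).count ((bl a.2.1)⁻¹ • x)) := by
      have : ((XS.o :: sites m (bs l)).map (fun y => bl a.2.1 • y)).count x =
          (XS.o :: sites m (bs l)).count ((bl a.2.1)⁻¹ • x) := by
        conv_lhs => rw [← smul_inv_smul (bl a.2.1) x]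
        exact List.count_map_of_injective _ _ (MulAction.injective (bl a.2.1)) _
      rw [bs_cons, sites, List.count_cons, this, List.count_cons]
      simp only [beq_iff_eq]; ring
    rw [hc]
    simp only [Pi.add_apply, Function.comp_apply]
    refine (abs_add_le _ _).trans ?_
    push_cast
    refine add_le_add (hs _ _) ((abs_add_le _ _).trans (add_le_add (hs _ _) (ih _)))
end
end SPE

namespace SPE

section
variable (m : ℤ → ZMod 2)

/-- the generators inside the ambient group -/
def gens : Set (PW m) := {bp m 1, bp m (-1), inj m (al true), inj m (tl true), inj m (tl false)}

/-- word length at most `k` -/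
def Lw (k : ℕ) (g : PW m) : Prop :=
  ∃ l : List (PW m), l.length ≤ k ∧ (∀ x ∈ l, x ∈ gens m) ∧ l.prod = g

variable {m}
lemma Lw_one (k : ℕ) : Lw m k 1 := ⟨[], by simp, by simp, rfl⟩

lemma Lw_mul {a b : ℕ} {g h : PW m} (hg : Lw m a g) (hh : Lw m b h) : Lw m (a + b) (g * h) := by
  obtain ⟨l, h1, h2, rfl⟩ := hg
  obtain ⟨l', h1', h2', rfl⟩ := hh
  refine ⟨l ++ l', by simp; omega, ?_, by simp⟩
  intro x hx
  rcases List.mem_append.1 hx with h | h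
  · exact h2 x h
  · exact h2' x h

lemma Lw_mono {a b : ℕ} {g : PW m} (hg : Lw m a g) (h : a ≤ b) : Lw m b g := by
  obtain ⟨l, h1, h2, h3⟩ := hg
  exact ⟨l, h1.trans h, h2, h3⟩

lemma Lw_gen {g : PW m} (hg : g ∈ gens m) : Lw m 1 g := ⟨[g], by simp, by simpa using hg, by simp⟩

lemma inj_mul (a b : Lm) : inj m (a * b) = inj m a * inj m b := by
  ext i <;> simp [inj]
lemma inj_one : inj m 1 = 1 := rfl
lemma inj_inv (a : Lm) : inj m a⁻¹ = (inj m a)⁻¹ := by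
  ext i <;> simp [inj]
lemma bp_add (k l : ℤ) : bp m (k + l) = bp m k * bp m l := by
  ext i <;> simp [bp, Pi.single_add]
lemma bp_zero : bp m 0 = 1 := by
  ext i <;> simp [bp]
lemma bp_neg (k : ℤ) : bp m (-k) = (bp m k)⁻¹ := by
  rw [eq_inv_iff_mul_eq_one, ← bp_add]; simp [bp_zero]

lemma al_true_sq : al true * al true = 1 := by
  ext i
  · simp only [al, Lm.mul_φ, Lm.one_φ, sub_zero]
    exact CharTwo.add_self_eq_zero _
  · simp [al]
lemma tl_mul : tl true * tl false = 1 := by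
  ext i <;> simp [tl, stp]

lemma gens_inv {g : PW m} (hg : g ∈ gens m) : g⁻¹ ∈ gens m := by
  have e1 : (inj m (al true))⁻¹ = inj m (al true) := by
    rw [inv_eq_iff_mul_eq_one, ← inj_mul, al_true_sq]; rfl
  have e2 : (inj m (tl true))⁻¹ = inj m (tl false) := by
    rw [inv_eq_iff_mul_eq_one, ← inj_mul, tl_mul]; rfl
  have e3 : (inj m (tl false))⁻¹ = inj m (tl true) := by rw [← e2, inv_inv]
  have e4 : (bp m 1)⁻¹ = bp m (-1) := (bp_neg 1).symm
  have e5 : (bp m (-1))⁻¹ = bp m 1 := by rw [← e4, inv_inv]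
  rcases hg with rfl | rfl | rfl | rfl | rfl
  · rw [e4]; simp [gens]
  · rw [e5]; simp [gens]
  · rw [e1]; simp [gens]
  · rw [e2]; simp [gens]
  · rw [e3]; simp [gens]

lemma Lw_inv {a : ℕ} {g : PW m} (hg : Lw m a g) : Lw m a g⁻¹ := by
  obtain ⟨l, h1, h2, rfl⟩ := hg
  refine ⟨(l.map (fun x => x⁻¹)).reverse, by simpa using h1, ?_, (List.prod_inv_reverse l).symm⟩
  intro x hx
  simp only [List.mem_reverse, List.mem_map] at hx
  obtain ⟨y, hy, rfl⟩ := hx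
  exact gens_inv (h2 y hy)

lemma Lw_bp_nat (k : ℕ) : Lw m k (bp m k) := by
  induction k with
  | zero => simpa [bp_zero] using Lw_one (m := m) 0
  | succ k ih =>
    push_cast
    rw [bp_add]
    exact Lw_mul ih (Lw_gen (by simp [gens]))

lemma Lw_bp (k : ℤ) : Lw m k.natAbs (bp m k) := by
  rcases Int.natAbs_eq k with h | h
  · conv => arg 3; rw [h]
    exact Lw_bp_nat _
  · conv => arg 3; rw [h]
    rw [bp_neg]; exact Lw_inv (Lw_bp_nat _)

lemma Lw_z_nat (k : ℕ) : Lw m k (inj m ⟨0, k⟩) := by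
  induction k with
  | zero => exact Lw_one (m := m) 0
  | succ k ih =>
    have : (⟨0, ((k + 1 : ℕ) : ℤ)⟩ : Lm) = ⟨0, k⟩ * tl true := by ext i <;> simp [tl, stp]
    rw [this, inj_mul]
    exact Lw_mul ih (Lw_gen (by simp [gens]))

lemma Lw_z (k : ℤ) : Lw m k.natAbs (inj m ⟨0, k⟩) := by
  rcases Int.natAbs_eq k with h | h
  · conv => arg 3; rw [h]
    exact Lw_z_nat _
  · have : (⟨0, k⟩ : Lm) = (⟨0, (k.natAbs : ℤ)⟩ : Lm)⁻¹ := by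
      ext i
      · simp
      · simp only [Lm.inv_z]; exact h
    rw [this, inj_inv]; exact Lw_inv (Lw_z_nat _)

lemma sweep_aux (M : ℕ) (φ : ℤ → ZMod 2) (k : ℕ) :
    Lw m (M + 2 * k) (inj m ⟨fun i => if -(M:ℤ) ≤ i ∧ i < -(M:ℤ) + k then φ i else 0, -(M:ℤ) + k⟩) := by
  induction k with
  | zero =>
    have : (⟨fun i => if -(M:ℤ) ≤ i ∧ i < -(M:ℤ) + (0:ℕ) then φ i else 0, -(M:ℤ) + (0:ℕ)⟩ : Lm) = ⟨0, -(M:ℤ)⟩ := by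
      ext i
      · simp
      · simp
    rw [this]
    exact Lw_mono (Lw_z _) (by omega)
  | succ k ih =>
    have : (⟨fun i => if -(M:ℤ) ≤ i ∧ i < -(M:ℤ) + (k+1:ℕ) then φ i else 0, -(M:ℤ) + (k+1:ℕ)⟩ : Lm) =
       ⟨fun i => if -(M:ℤ) ≤ i ∧ i < -(M:ℤ) + k then φ i else 0, -(M:ℤ) + k⟩ *
         ⟨Pi.single 0 (φ (-(M:ℤ) + k)), 0⟩ * tl true := by
      ext i
      · simp only [Lm.mul_φ, tl, Pi.single_apply, Pi.zero_apply, add_zero]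
        by_cases h : i = -(M:ℤ) + k
        · subst h; simp
        · rw [if_neg (show ¬ (i - (-(M:ℤ) + k) = 0) by omega), add_zero]
          refine if_congr ?_ rfl rfl
          push_cast; omega
      · simp [tl, stp]; ring
    rw [this, inj_mul, inj_mul]
    refine Lw_mono (Lw_mul (Lw_mul ih (b := 1) ?_) (Lw_gen (by simp [gens]))) (by omega)
    have h2 : ∀ a : ZMod 2, a = 0 ∨ a = 1 := by decide
    rcases h2 (φ (-(M:ℤ) + k)) with h | h <;> rw [h]
    · have : (⟨Pi.single 0 0, 0⟩ : Lm) = 1 := by ext i <;> simp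
      rw [this]; exact Lw_one _
    · have : (⟨Pi.single 0 1, 0⟩ : Lm) = al true := by simp [al]
      rw [this]; exact Lw_gen (by simp [gens])

lemma sweep {M : ℕ} {γ : Lm} (h : Inn M γ) : Lw m (7 * M + 3) (inj m γ) := by
  have h1 := Lw_mul (sweep_aux (m := m) M γ.φ (2 * M + 1)) (Lw_z (m := m) (γ.z - M - 1))
  rw [← inj_mul] at h1
  have e : (⟨fun i => if -(M:ℤ) ≤ i ∧ i < -(M:ℤ) + (2 * M + 1 : ℕ) then γ.φ i else 0, -(M:ℤ) + (2 * M + 1 : ℕ)⟩ : Lm)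
      * ⟨0, γ.z - M - 1⟩ = γ := by
    ext i
    · simp only [Lm.mul_φ, Pi.zero_apply, add_zero]
      split_ifs with hh
      · rfl
      · rw [h.2 i (by push_cast at hh; omega)]
    · simp only [Lm.mul_z]; push_cast; ring
  rw [e] at h1
  refine Lw_mono h1 ?_
  have := h.1
  omega

lemma sweepF_aux (M : ℕ) (f : ℤ → ℤ) (k : ℕ) :
    Lw m (M + k + ∑ j ∈ Finset.range k, (f (-(M:ℤ) + j)).natAbs)
      ⟨fun x => if x.ψ = 0 ∧ -(M:ℤ) ≤ x.u ∧ x.u < -(M:ℤ) + k then f x.u else 0, ⟨0, -(M:ℤ) + k⟩⟩ := by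
  induction k with
  | zero =>
    have : (⟨fun x => if x.ψ = 0 ∧ -(M:ℤ) ≤ x.u ∧ x.u < -(M:ℤ) + (0:ℕ) then f x.u else 0, ⟨0, -(M:ℤ) + (0:ℕ)⟩⟩ : PW m)
       = inj m ⟨0, -(M:ℤ)⟩ := by
      ext i
      · simp [inj]
      · simp [inj]
      · simp [inj]
    rw [this]
    exact Lw_mono (Lw_z _) (by omega)
  | succ k ih =>
    have : (⟨fun x => if x.ψ = 0 ∧ -(M:ℤ) ≤ x.u ∧ x.u < -(M:ℤ) + (k+1:ℕ) then f x.u else 0, ⟨0, -(M:ℤ) + (k+1:ℕ)⟩⟩ : PW m) =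
       ⟨fun x => if x.ψ = 0 ∧ -(M:ℤ) ≤ x.u ∧ x.u < -(M:ℤ) + k then f x.u else 0, ⟨0, -(M:ℤ) + k⟩⟩ *
         bp m (f (-(M:ℤ) + k)) * inj m (tl true) := by
      ext x
      · simp only [PW.mul_F, PW.mul_g, bp, inj, Pi.zero_apply, add_zero, Pi.single_apply]
        have hx : (⟨0, -(M:ℤ) + k⟩ : Lm)⁻¹ • x = XS.o ↔ x.ψ = 0 ∧ x.u = -(M:ℤ) + k := by
          rw [inv_smul_eq_iff]
          constructor
          · rintro rfl
            refine ⟨?_, by simp⟩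
            funext s; simp
          · rintro ⟨h1, h2⟩
            ext s
            · simp [h2]
            · simp [h1]
        rw [if_congr hx rfl rfl]
        by_cases hψ : x.ψ = 0
        · simp only [hψ, true_and]
          by_cases h : x.u = -(M:ℤ) + k
          · rw [h]; simp
          · rw [if_neg h, add_zero]
            refine if_congr ?_ rfl rfl
            push_cast; omega
        · simp [hψ]
      · simp [bp, inj, tl]
      · simp [bp, inj, tl, stp]; ring
    rw [this, Finset.sum_range_succ]
    exact Lw_mono (Lw_mul (Lw_mul ih (Lw_bp _)) (Lw_gen (by simp [gens]))) (by omega)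

lemma sweepF (M : ℕ) (f : ℤ → ℤ) :
    Lw m (4 * M + 2 + ∑ j ∈ Finset.range (2 * M + 1), (f (-(M:ℤ) + j)).natAbs)
      ⟨fun x => if x.ψ = 0 ∧ x.u.natAbs ≤ M then f x.u else 0, 1⟩ := by
  have h1 := Lw_mul (sweepF_aux (m := m) M f (2 * M + 1)) (Lw_z (m := m) (- M - 1))
  refine Lw_mono (a := (M + (2 * M + 1) + ∑ j ∈ Finset.range (2 * M + 1), (f (-(M:ℤ) + j)).natAbs) +
    (- (M:ℤ) - 1).natAbs) ?_ (by omega)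
  · convert h1 using 1
    ext x
    · simp only [PW.mul_F, inj, Pi.zero_apply, add_zero]
      refine if_congr ?_ rfl rfl
      push_cast
      refine and_congr_right fun _ => ?_
      omega
    · simp [inj]
    · simp only [inj, PW.mul_g, Lm.mul_z, Lm.one_z]; push_cast; ring

lemma conjF {a b : ℕ} (c : Lm) (F : XS m → ℤ) (hc : Lw m a (inj m c)) (hF : Lw m b ⟨F, 1⟩) :
    Lw m (a + b + a) ⟨fun x => F (c⁻¹ • x), 1⟩ := by
  have := Lw_mul (Lw_mul hc hF) (Lw_inv hc)
  convert this using 1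
  have h1 : (inj m c * (⟨F, 1⟩ : PW m) * (inj m c)⁻¹).g = 1 := by simp [inj]
  have h2 : (inj m c * (⟨F, 1⟩ : PW m) * (inj m c)⁻¹).F = fun x => F (c⁻¹ • x) := by
    funext x; simp [inj]
  exact (PW.ext h2 h1).symm

lemma cover_len (M : ℕ) (Θ : List (Finset.Icc (-(M:ℤ)) M → ZMod 2)) (F : XS m → ℤ)
    (hF : ∀ x, F x ≠ 0 → x.u.natAbs ≤ M ∧ ∃ θ ∈ Θ, pat m x.u θ = x.ψ) :
    Lw m (∑ x ∈ Box m M, (F x).natAbs + Θ.length * (18 * M + 8)) ⟨F, 1⟩ := by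
  induction Θ generalizing F with
  | nil =>
    have : F = 0 := by
      funext x
      by_contra h
      obtain ⟨_, θ, h, _⟩ := hF x h
      simp at h
    rw [this]
    exact Lw_one _
  | cons θ Θ ih =>
    set F1 : XS m → ℤ := fun x => if pat m x.u θ = x.ψ then F x else 0 with hF1
    set F2 : XS m → ℤ := fun x => if pat m x.u θ = x.ψ then 0 else F x with hF2
    have e : (⟨F, 1⟩ : PW m) = ⟨F1, 1⟩ * ⟨F2, 1⟩ := by
      have h1 : ((⟨F1, 1⟩ : PW m) * ⟨F2, 1⟩).F = F := by
        funext x; simp only [PW.mul_F, inv_one, one_smul, hF1, hF2]; split_ifs <;> simp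
      have h2 : ((⟨F1, 1⟩ : PW m) * ⟨F2, 1⟩).g = 1 := by simp
      exact (PW.ext h1 h2).symm
    have h2 := ih F2 (by
      intro x hx
      simp only [hF2] at hx
      split_ifs at hx with hp
      · exact absurd rfl hx
      · obtain ⟨h1, θ', h3, h4⟩ := hF x hx
        refine ⟨h1, θ', ?_, h4⟩
        rcases List.mem_cons.1 h3 with rfl | h
        · exact absurd h4 hp
        · exact h)
    set f : ℤ → ℤ := fun u => F ⟨u, pat m u θ⟩ with hf
    have hc : Lw m (7 * M + 3) (inj m ⟨ex θ, 0⟩) := sweep ⟨by simp, fun i hi => ex_out θ i hi⟩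
    have h1 := conjF _ _ hc (sweepF (m := m) M f)
    have e1 : (fun x : XS m => if (((⟨ex θ, 0⟩ : Lm)⁻¹ • x).ψ = 0 ∧ ((⟨ex θ, 0⟩ : Lm)⁻¹ • x).u.natAbs ≤ M)
        then f ((⟨ex θ, 0⟩ : Lm)⁻¹ • x).u else 0) = F1 := by
      funext x
      have hu : ((⟨ex θ, 0⟩ : Lm)⁻¹ • x).u = x.u := by simp
      have hψ : ((⟨ex θ, 0⟩ : Lm)⁻¹ • x).ψ = 0 ↔ pat m x.u θ = x.ψ := by
        rw [funext_iff, funext_iff]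
        refine forall_congr' fun s => ?_
        simp only [XS.smul_ψ, Lm.inv_φ, Lm.inv_z, pat, Pi.zero_apply, neg_zero, add_zero, mul_neg]
        rw [← sub_eq_add_neg, sub_eq_zero, eq_comm]
      rw [hu, if_congr (and_congr_left' hψ) rfl rfl]
      simp only [hF1, hf]
      by_cases hp : pat m x.u θ = x.ψ
      · rw [if_pos hp]
        by_cases hx : x.u.natAbs ≤ M
        · rw [if_pos ⟨hp, hx⟩, hp]
        · rw [if_neg (fun h => hx h.2)]
          by_contra h
          exact hx (hF x (Ne.symm h)).1
      · rw [if_neg hp, if_neg (fun h => hp h.1)]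
    rw [e1] at h1
    rw [e]
    refine Lw_mono (Lw_mul h1 h2) ?_
    have hs : ∑ x ∈ Box m M, (F x).natAbs = ∑ x ∈ Box m M, (F1 x).natAbs + ∑ x ∈ Box m M, (F2 x).natAbs := by
      rw [← Finset.sum_add_distrib]
      refine Finset.sum_congr rfl fun x _ => ?_
      simp only [hF1, hF2]; split_ifs <;> simp
    have hs1 : ∑ j ∈ Finset.range (2 * M + 1), (f (-(M:ℤ) + j)).natAbs ≤ ∑ x ∈ Box m M, (F1 x).natAbs := by
      have hinj : Set.InjOn (fun j : ℕ => (⟨-(M:ℤ) + j, pat m (-(M:ℤ) + j) θ⟩ : XS m)) (Finset.range (2 * M + 1)) := by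
        intro a _ b _ hab
        have := congrArg XS.u hab
        simp at this; exact this
      calc ∑ j ∈ Finset.range (2 * M + 1), (f (-(M:ℤ) + j)).natAbs
          = ∑ x ∈ (Finset.range (2 * M + 1)).image (fun j : ℕ => (⟨-(M:ℤ) + j, pat m (-(M:ℤ) + j) θ⟩ : XS m)),
            (F1 x).natAbs := by
            rw [Finset.sum_image hinj]
            refine Finset.sum_congr rfl fun j _ => ?_
            simp [hF1, hf]
        _ ≤ _ := by
            refine Finset.sum_le_sum_of_subset ?_
            intro x hx
            rw [Finset.mem_image] at hx
            obtain ⟨j, hj, rfl⟩ := hx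
            rw [Finset.mem_range] at hj
            have := mem_Box (m := m) (M := M) (γ := ⟨ex θ, -(M:ℤ) + j⟩)
              ⟨by show (-(M:ℤ) + j).natAbs ≤ M; omega, fun i hi => ex_out θ i hi⟩
            convert this using 1
            ext s <;> simp [pat]
    rw [hs, List.length_cons, add_mul]
    omega

lemma greedy (hm : ∀ s ≤ 0, m s = 0) (M N : ℕ) :
    ∃ Θ : List (Finset.Icc (-(M:ℤ)) M → ZMod 2), Θ.length = N ∧
      (((Box m M).filter (fun x => ∀ θ ∈ Θ, pat m x.u θ ≠ x.ψ)).card : ℝ) ≤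
        (Box m M).card * (1 - 1 / 2 ^ kap m (2 * M)) ^ N := by
  induction N with
  | zero => exact ⟨[], rfl, by simp⟩
  | succ N ih =>
    obtain ⟨Θ, hl, hc⟩ := ih
    set U := (Box m M).filter (fun x => ∀ θ ∈ Θ, pat m x.u θ ≠ x.ψ) with hU
    set Q : ℕ := 2 ^ kap m (2 * M) with hQ
    have hQ0 : (0:ℝ) < Q := by rw [hQ]; positivity
    have key : ∃ θ ∈ (Finset.univ : Finset (Finset.Icc (-(M:ℤ)) M → ZMod 2)),
        (U.card : ℝ) / Q ≤ ((U.filter (fun x => pat m x.u θ = x.ψ)).card : ℝ) := by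
      refine Finset.exists_le_of_sum_le ⟨0, Finset.mem_univ _⟩ ?_
      have h1 : ∑ θ : (Finset.Icc (-(M:ℤ)) M → ZMod 2), ((U.filter (fun x => pat m x.u θ = x.ψ)).card : ℝ)
          = ∑ x ∈ U, (((Finset.univ : Finset (Finset.Icc (-(M:ℤ)) M → ZMod 2)).filter
              (fun θ => pat m x.u θ = x.ψ)).card : ℝ) := by
        simp only [Finset.card_filter, Nat.cast_sum]
        rw [Finset.sum_comm]
      rw [h1, Finset.sum_const, nsmul_eq_mul]
      rw [← mul_div_assoc, mul_comm, mul_div_assoc, ← nsmul_eq_mul, ← Finset.sum_const]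
      refine Finset.sum_le_sum fun x hx => ?_
      rw [div_le_iff₀' hQ0]
      exact_mod_cast cover_frac hm (Finset.mem_filter.1 hx).1
    obtain ⟨θ, -, hθ⟩ := key
    refine ⟨θ :: Θ, by simp [hl], ?_⟩
    have e : ((Box m M).filter (fun x => ∀ θ' ∈ θ :: Θ, pat m x.u θ' ≠ x.ψ)) =
        U.filter (fun x => ¬ pat m x.u θ = x.ψ) := by
      ext x; simp [hU]; tauto
    have h2 := Finset.card_filter_add_card_filter_not (s := U) (fun x => pat m x.u θ = x.ψ)
    have h3 : ((U.filter (fun x => pat m x.u θ = x.ψ)).card : ℝ) +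
      ((U.filter (fun x => ¬ pat m x.u θ = x.ψ)).card : ℝ) = U.card := by exact_mod_cast h2
    rw [e]
    have hQ1 : (1:ℝ) ≤ Q := by rw [hQ]; exact_mod_cast Nat.one_le_two_pow
    have h4 : (0:ℝ) ≤ 1 - 1 / Q := by
      rw [sub_nonneg, div_le_one hQ0]; exact hQ1
    have hQc : (2:ℝ) ^ kap m (2 * M) = Q := by rw [hQ]; push_cast; rfl
    rw [hQc] at hc ⊢
    calc ((U.filter (fun x => ¬ pat m x.u θ = x.ψ)).card : ℝ) ≤ U.card - U.card / Q := by linarith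
      _ = U.card * (1 - 1 / Q) := by ring
      _ ≤ ((Box m M).card * (1 - 1 / Q) ^ N) * (1 - 1 / Q) := by gcongr
      _ = _ := by ring

/-- size of a covering family -/
noncomputable def NN (m : ℤ → ZMod 2) (M : ℕ) : ℕ :=
  ⌊(2:ℝ) ^ kap m (2 * M) * Real.log ((2 * M + 1) * 2 ^ kap m (2 * M))⌋₊ + 1

lemma cover (hm : ∀ s ≤ 0, m s = 0) (M : ℕ) :
    ∃ Θ : List (Finset.Icc (-(M:ℤ)) M → ZMod 2), Θ.length = NN m M ∧
      ∀ x ∈ Box m M, ∃ θ ∈ Θ, pat m x.u θ = x.ψ := by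
  obtain ⟨Θ, h1, h2⟩ := greedy hm M (NN m M)
  refine ⟨Θ, h1, ?_⟩
  have hQ0 : (0:ℝ) < 2 ^ kap m (2 * M) := by positivity
  have hQ1 : (1:ℝ) ≤ 2 ^ kap m (2 * M) := one_le_pow₀ (by norm_num)
  set Q : ℝ := 2 ^ kap m (2 * M) with hQ
  have hB : ((Box m M).card : ℝ) ≤ (2 * M + 1) * Q := by rw [hQ]; exact_mod_cast Box_card hm M
  have h3 : (1 - 1 / Q) ≤ Real.exp (-(1 / Q)) := by
    have := Real.add_one_le_exp (-(1 / Q)); linarith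
  have h4 : (0:ℝ) ≤ 1 - 1 / Q := by rw [sub_nonneg, div_le_one hQ0]; exact hQ1
  have hpos : 0 < (2 * (M:ℝ) + 1) * Q := by positivity
  have h5 : ((Box m M).card : ℝ) * (1 - 1 / Q) ^ NN m M < 1 := by
    calc ((Box m M).card : ℝ) * (1 - 1 / Q) ^ NN m M
        ≤ ((2 * M + 1) * Q) * Real.exp (-(1 / Q)) ^ NN m M := by gcongr
      _ = Real.exp (Real.log ((2 * M + 1) * Q) + NN m M * (-(1 / Q))) := by
          rw [Real.exp_add, Real.exp_log hpos, ← Real.exp_nat_mul]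
      _ < 1 := by
          rw [Real.exp_lt_one_iff]
          have : Q * Real.log ((2 * M + 1) * Q) < NN m M := by
            unfold NN; push_cast; exact Nat.lt_floor_add_one _
          have h6 : Real.log ((2 * M + 1) * Q) < NN m M / Q := by
            rw [lt_div_iff₀' hQ0]; exact this
          have : (NN m M : ℝ) * (-(1 / Q)) = - (NN m M / Q) := by ring
          linarith
  have h6 : ((Box m M).filter (fun x => ∀ θ ∈ Θ, pat m x.u θ ≠ x.ψ)).card = 0 := by
    have := h2.trans_lt h5
    have : ((Box m M).filter (fun x => ∀ θ ∈ Θ, pat m x.u θ ≠ x.ψ)).card < 1 := by exact_mod_cast this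
    omega
  intro x hx
  by_contra hcon
  push Not at hcon
  rw [Finset.card_eq_zero] at h6
  have : x ∈ (Box m M).filter (fun x => ∀ θ ∈ Θ, pat m x.u θ ≠ x.ψ) := Finset.mem_filter.2 ⟨hx, hcon⟩
  rw [h6] at this
  simp at this

/-- upper bound for the word length -/
lemma Lw_main (hm : ∀ s ≤ 0, m s = 0) (M : ℕ) (g : PW m) (hg : Inn M g.g) (hF : ∀ x, g.F x ≠ 0 → x ∈ Box m M) :
    Lw m (∑ x ∈ Box m M, (g.F x).natAbs + NN m M * (18 * M + 8) + (7 * M + 3)) g := by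
  obtain ⟨Θ, h1, h2⟩ := cover hm M
  have h3 := cover_len M Θ g.F (fun x hx => by
    obtain ⟨_, h, _⟩ := Box_spec (hF x hx)
    exact ⟨h, h2 x (hF x hx)⟩)
  rw [h1] at h3
  have := Lw_mul h3 (sweep (m := m) hg)
  convert this using 1
  ext i <;> simp [inj]

lemma gens_F (g : PW m) (hg : g ∈ gens m) (T : Finset (XS m)) : ∑ x ∈ T, (g.F x).natAbs ≤ 1 := by
  have h1 : ∀ k : ℤ, k.natAbs ≤ 1 → ∑ x ∈ T, ((bp m k).F x).natAbs ≤ 1 := by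
    intro k hk
    have : ∀ x ∈ T, ((bp m k).F x).natAbs = if x = XS.o then k.natAbs else 0 := by
      intro x _; simp only [bp, Pi.single_apply]; split_ifs <;> simp
    rw [Finset.sum_congr rfl this, Finset.sum_ite_eq']
    split_ifs <;> omega
  have h2 : ∀ k : Lm, ∑ x ∈ T, ((inj m k).F x).natAbs ≤ 1 := by intro k; simp [inj]
  rcases hg with rfl | rfl | rfl | rfl | rfl
  · exact h1 _ (by simp)
  · exact h1 _ (by simp)
  all_goals exact h2 _

lemma Lw_lower (l : List (PW m)) (hl : ∀ x ∈ l, x ∈ gens m) (T : Finset (XS m)) :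
    ∑ x ∈ T, (l.prod.F x).natAbs ≤ l.length := by
  induction l generalizing T with
  | nil => simp
  | cons s l ih =>
    have h1 := gens_F s (hl s (by simp)) T
    have h2 := ih (fun x hx => hl x (by simp [hx])) (T.image (fun x => s.g⁻¹ • x))
    rw [Finset.sum_image (fun a _ b _ h => MulAction.injective _ h)] at h2
    rw [List.prod_cons, List.length_cons]
    have h3 : ∑ x ∈ T, ((s * l.prod).F x).natAbs ≤ ∑ x ∈ T, ((s.F x).natAbs + (l.prod.F (s.g⁻¹ • x)).natAbs) :=
      Finset.sum_le_sum fun x _ => Int.natAbs_add_le _ _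
    rw [Finset.sum_add_distrib] at h3
    simp only at h2
    omega
end
end SPE

namespace SPE

section gen
variable {G : Type} [Group G] {A : Type} [Fintype A] [Nonempty A]

/-- possible positions at time `n` -/
noncomputable def PP (s : A → G) (n : ℕ) : Finset G :=
  (List.finite_length_eq A n).toFinset.image (fun l => (l.map s).prod)

lemma mem_PP (s : A → G) (n : ℕ) (l : List A) (hl : l.length = n) : (l.map s).prod ∈ PP s n :=
  Finset.mem_image_of_mem _ ((List.finite_length_eq A n).mem_toFinset.2 hl)

lemma mem_PP_iff (s : A → G) (n : ℕ) (g : G) (hg : g ∈ PP s n) :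
    ∃ l : List A, l.length = n ∧ (l.map s).prod = g := by
  unfold PP at hg
  obtain ⟨l, hl, h⟩ := Finset.mem_image.1 hg
  exact ⟨l, (List.finite_length_eq A n).mem_toFinset.1 hl, h⟩

noncomputable def mu (s : A → G) (g : G) : ℝ := av fun a => if s a = g then 1 else 0

lemma EL_nonneg (n : ℕ) (f : List A → ℝ) (h : ∀ l, 0 ≤ f l) : 0 ≤ EL A n f := by
  have := EL_mono (A := A) n (f := fun _ => 0) (g := f) (fun l _ => h l)
  rwa [EL_const] at this

lemma EL_out (s : A → G) (n : ℕ) (g : G) (hg : g ∉ PP s n) :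
    EL A n (fun l => if (l.map s).prod = g then (1:ℝ) else 0) = 0 := by
  refine Eq.trans ?_ (EL_const (A := A) n 0)
  refine EL_congr n fun l hl => ?_
  rw [if_neg]; rintro rfl; exact hg (mem_PP s n l hl)

lemma E_sum (s : A → G) (n : ℕ) (u : G → ℝ) :
    ∑ g ∈ PP s n, EL A n (fun l => if (l.map s).prod = g then (1:ℝ) else 0) * u g =
      EL A n (fun l => u (l.map s).prod) := by
  have : ∀ g, EL A n (fun l => if (l.map s).prod = g then (1:ℝ) else 0) * u g =
      EL A n (fun l => if (l.map s).prod = g then u g else 0) := by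
    intro g; rw [mul_comm, ← EL_mul_left]; congr 1; funext l; split_ifs <;> simp
  simp only [this]
  rw [← EL_sum]
  refine EL_congr n fun l hl => ?_
  rw [Finset.sum_ite_eq, if_pos (mem_PP s n l hl)]

lemma E_tsum (s : A → G) (n : ℕ) (u : G → ℝ) :
    ∑' g, EL A n (fun l => if (l.map s).prod = g then (1:ℝ) else 0) * u g =
      EL A n (fun l => u (l.map s).prod) := by
  rw [← E_sum, tsum_eq_sum]
  intro g hg
  rw [EL_out s n g hg, zero_mul]

lemma convPow_eq (s : A → G) (n : ℕ) (g : G) :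
    convPow (mu s) n g = EL A n (fun l => if (l.map s).prod = g then (1:ℝ) else 0) := by
  induction n generalizing g with
  | zero => simp [convPow, EL_zero, eq_comm]
  | succ n ih =>
    rw [convPow, conv]
    simp only [ih]
    rw [E_tsum s n (fun h => mu s (h⁻¹ * g)), EL_snoc]
    congr 1; funext l
    unfold mu
    congr 1; funext a
    simp only [List.map_append, List.map_cons, List.map_nil, List.prod_append, List.prod_singleton]
    refine if_congr ?_ rfl rfl
    rw [eq_inv_mul_iff_mul_eq]

lemma speed_eq (s : A → G) (S : Set G) (n : ℕ) :
    speed S (mu s) n = EL A n (fun l => (wordLength S (l.map s).prod : ℝ)) := by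
  unfold speed
  simp only [convPow_eq]
  exact E_tsum s n (fun g => (wordLength S g : ℝ))

lemma entropy_eq (s : A → G) (n : ℕ) : entropy (convPow (mu s) n) =
    ∑ g ∈ PP s n, Real.negMulLog (EL A n (fun l => if (l.map s).prod = g then (1:ℝ) else 0)) := by
  unfold entropy
  simp only [convPow_eq]
  rw [tsum_eq_sum]
  intro g hg
  rw [EL_out s n g hg, Real.negMulLog_zero]

lemma gibbs (p l : ℝ) (hp : 0 ≤ p) : Real.negMulLog p ≤ p * l + Real.exp (-l) := by
  rcases hp.eq_or_lt with rfl | hp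
  · simp [Real.exp_nonneg]
  · have h := Real.add_one_le_exp (-l - Real.log p)
    have h2 : Real.exp (-l - Real.log p) = Real.exp (-l) / p := by
      rw [Real.exp_sub, Real.exp_log hp]
    rw [h2, le_div_iff₀ hp] at h
    unfold Real.negMulLog
    nlinarith

lemma entropy_le (s : A → G) (n : ℕ) (ℓ : G → ℝ) : entropy (convPow (mu s) n) ≤
    EL A n (fun l => ℓ (l.map s).prod) + ∑ g ∈ PP s n, Real.exp (-(ℓ g)) := by
  rw [entropy_eq, ← E_sum s n ℓ, ← Finset.sum_add_distrib]
  refine Finset.sum_le_sum fun g _ => gibbs _ _ (EL_nonneg n _ fun l => ?_)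
  split_ifs <;> norm_num

lemma mu_total (s : A → G) : ∑' g, mu s g = 1 := by
  have := E_tsum s 1 (fun _ => 1)
  simp only [← convPow_eq] at this
  rw [EL_const] at this
  rw [← this]
  congr 1; funext g
  rw [convPow_eq, EL_succ]
  simp [EL_zero, mu]

lemma mu_nonneg (s : A → G) (g : G) : 0 ≤ mu s g := by
  have := av_mono (A := A) (f := fun _ => 0) (g := fun a => if s a = g then (1:ℝ) else 0)
    (fun a => by split_ifs <;> norm_num)
  rwa [av_const] at this

lemma mu_supp (s : A → G) (a : A) : s a ∈ Function.support (mu s) := by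
  rw [Function.mem_support]
  unfold mu av
  have h1 : (0:ℝ) < (Fintype.card A : ℝ)⁻¹ := by
    have := Fintype.card_pos (α := A); positivity
  have h2 : (0:ℝ) < ∑ b, if s b = s a then (1:ℝ) else 0 := by
    refine Finset.sum_pos' (fun b _ => by split_ifs <;> norm_num) ⟨a, Finset.mem_univ _, by simp⟩
  exact (mul_pos h1 h2).ne'

lemma mu_finSupp (s : A → G) : (Function.support (mu s)).Finite := by
  refine (Set.finite_range s).subset ?_
  intro g hg
  by_contra h
  apply hg
  unfold mu
  refine Eq.trans ?_ (av_const (A := A) 0)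
  congr 1; funext a
  rw [if_neg]; rintro rfl; exact h ⟨a, rfl⟩

lemma mu_symm (s : A → G) (e : A ≃ A) (he : ∀ a, s (e a) = (s a)⁻¹) (g : G) : mu s g⁻¹ = mu s g := by
  unfold mu
  rw [av_equiv e]
  simp only [he, inv_inj]
end gen

section
variable (m : ℤ → ZMod 2)

/-- the group -/
abbrev GG : Type := ↥(Subgroup.closure (gens m))

variable {m}
lemma inj_al_mem (x : Bool) : inj m (al x) ∈ Subgroup.closure (gens m) := by
  cases x
  · have : al false = 1 := by ext i <;> simp [al]
    rw [this]; exact one_mem _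
  · exact Subgroup.subset_closure (by simp [gens])
lemma inj_tl_mem (x : Bool) : inj m (tl x) ∈ Subgroup.closure (gens m) := by
  cases x <;> exact Subgroup.subset_closure (by simp [gens])
lemma bp_mem (e : Bool × Bool) : bp m (ev e) ∈ Subgroup.closure (gens m) := by
  rcases e with ⟨_ | _, _ | _⟩ <;> simp only [ev, Bool.toNat_false, Bool.toNat_true, Nat.cast_zero,
    Nat.cast_one, sub_self, sub_zero, zero_sub, bp_zero, one_mem] <;>
    exact Subgroup.subset_closure (by simp [gens])
lemma sl_mem (a : SL) : sl m a ∈ Subgroup.closure (gens m) := by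
  unfold sl bl
  rw [inj_mul, inj_mul]
  exact mul_mem (mul_mem (bp_mem _) (mul_mem (mul_mem (inj_al_mem _) (inj_tl_mem _)) (inj_al_mem _))) (bp_mem _)

variable (m)
noncomputable def sG (a : SL) : GG m := ⟨sl m a, sl_mem a⟩
def SS : Set (GG m) := Subtype.val ⁻¹' gens m

variable {m}
lemma sG_prod (l : List SL) : ((l.map (sG m)).prod : GG m).val = sw m l := by
  induction l with
  | nil => rfl
  | cons a l ih => rw [List.map_cons, List.prod_cons, sw_cons, ← ih]; rfl

lemma isGen : IsGenSet (SS m) where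
  finite := by
    refine Set.Finite.preimage (Subtype.val_injective.injOn) ?_
    unfold gens; exact Set.toFinite _
  symm := fun s hs => gens_inv (m := m) hs
  gen := Subgroup.closure_closure_coe_preimage

def swapE : (Bool × Bool) ≃ (Bool × Bool) := Equiv.prodComm _ _
lemma ev_swap (e : Bool × Bool) : ev (e.2, e.1) = - ev e := by unfold ev; ring

def invE : SL ≃ SL where
  toFun a := ((a.2.2.2, a.2.2.1), (a.2.1.2.2, !a.2.1.2.1, a.2.1.1), (a.1.2, a.1.1))
  invFun a := ((a.2.2.2, a.2.2.1), (a.2.1.2.2, !a.2.1.2.1, a.2.1.1), (a.1.2, a.1.1))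
  left_inv a := by simp
  right_inv a := by simp

lemma al_inv (x : Bool) : (al x)⁻¹ = al x := by
  cases x
  · have : al false = 1 := by ext i <;> simp [al]
    rw [this]; simp
  · rw [inv_eq_iff_mul_eq_one, al_true_sq]
lemma tl_inv (x : Bool) : (tl x)⁻¹ = tl (!x) := by
  ext i
  · simp [tl]
  · cases x <;> simp [tl, stp]
lemma bl_inv (β : BL) : (bl β)⁻¹ = bl (β.2.2, !β.2.1, β.1) := by
  unfold bl
  rw [mul_inv_rev, mul_inv_rev, al_inv, al_inv, tl_inv, mul_assoc]

lemma sG_inv (a : SL) : sG m (invE a) = (sG m a)⁻¹ := by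
  apply Subtype.ext
  show sl m (invE a) = (sl m a)⁻¹
  unfold sl
  rw [mul_inv_rev, mul_inv_rev, ← bp_neg, ← bp_neg, ← inj_inv, bl_inv, ← ev_swap, ← ev_swap, mul_assoc]
  rfl

lemma isStep : IsStepDist (mu (sG m)) where
  nonneg := mu_nonneg _
  total := mu_total _
  symm := mu_symm _ invE sG_inv
  finSupp := mu_finSupp _
  gen := by
    rw [eq_top_iff, ← (isGen (m := m)).gen, Subgroup.closure_le]
    set K := Subgroup.closure (Function.support (mu (sG m))) with hK
    have hs : ∀ a, sG m a ∈ K := fun a => Subgroup.subset_closure (mu_supp _ a)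
    have e0 : ∀ b, ev (b, b) = 0 := by intro b; simp [ev]
    have e1 : ev (true, false) = 1 := by simp [ev]
    have ea : al false = 1 := by ext i <;> simp [al]
    have ht : ∀ (h : inj m (tl true) ∈ Subgroup.closure (gens m)), (⟨inj m (tl true), h⟩ : GG m) ∈ K := by
      intro h
      convert hs ((false, false), (false, true, false), (false, false)) using 1
      apply Subtype.ext
      show _ = sl m _
      simp [sl, e0, bp_zero, bl, ea]
    have hT : (⟨inj m (tl true), inj_tl_mem true⟩ : GG m) ∈ K := ht _
    have ha : ∀ (h : inj m (al true) ∈ Subgroup.closure (gens m)), (⟨inj m (al true), h⟩ : GG m) ∈ K := by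
      intro h
      have := mul_mem (hs ((false, false), (true, true, false), (false, false))) (inv_mem hT)
      convert this using 1
      apply Subtype.ext
      show _ = sl m _ * (inj m (tl true))⁻¹
      simp [sl, e0, bp_zero, bl, ea, inj_mul]
    have hb : ∀ (h : bp m 1 ∈ Subgroup.closure (gens m)), (⟨bp m 1, h⟩ : GG m) ∈ K := by
      intro h
      have := mul_mem (hs ((true, false), (false, true, false), (false, false))) (inv_mem hT)
      convert this using 1
      apply Subtype.ext
      show _ = sl m _ * (inj m (tl true))⁻¹
      simp [sl, e0, e1, bp_zero, bl, ea]
    rintro ⟨g, hg⟩ hgS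
    rcases hgS with rfl | rfl | rfl | rfl | rfl
    · exact hb _
    · show _ ∈ K
      have h1 := inv_mem (hb (bp_mem (true, false)))
      convert h1 using 1
      exact Subtype.ext (bp_neg 1)
    · exact ha _
    · exact ht _
    · show _ ∈ K
      have h1 := inv_mem hT
      convert h1 using 1
      apply Subtype.ext
      show _ = (inj m (tl true))⁻¹
      rw [← inj_inv, tl_inv]; rfl

lemma wl_le (g : GG m) (k : ℕ) (h : Lw m k g.val) : wordLength (SS m) g ≤ k := by
  obtain ⟨l, h1, h2, h3⟩ := h
  refine le_trans ?_ h1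
  refine Nat.sInf_le ⟨l.attach.map (fun x => ⟨x.1, Subgroup.subset_closure (h2 x.1 x.2)⟩), by simp, ?_, ?_⟩
  · intro x hx
    rw [List.mem_map] at hx
    obtain ⟨y, _, rfl⟩ := hx
    exact h2 y.1 y.2
  · apply Subtype.ext
    rw [← h3, ← Subgroup.coe_subtype, map_list_prod, List.map_map]
    congr 1
    conv_rhs => rw [← List.attach_map_subtype_val l]
    rfl

lemma le_wl (g : GG m) (hne : ∃ k, Lw m k g.val) (T : Finset (XS m)) :
    ∑ x ∈ T, (g.val.F x).natAbs ≤ wordLength (SS m) g := by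
  have hn : {n | ∃ l : List (GG m), l.length = n ∧ (∀ x ∈ l, x ∈ SS m) ∧ l.prod = g}.Nonempty := by
    obtain ⟨k, l, h1, h2, h3⟩ := hne
    refine ⟨_, l.attach.map (fun x => ⟨x.1, Subgroup.subset_closure (h2 x.1 x.2)⟩), rfl, ?_, ?_⟩
    · intro x hx
      rw [List.mem_map] at hx
      obtain ⟨y, _, rfl⟩ := hx
      exact h2 y.1 y.2
    · apply Subtype.ext
      rw [← h3, ← Subgroup.coe_subtype, map_list_prod, List.map_map]
      congr 1
      conv_rhs => rw [← List.attach_map_subtype_val l]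
      rfl
  obtain ⟨l, h1, h2, h3⟩ := Nat.sInf_mem hn
  unfold wordLength
  rw [← h1]
  have := Lw_lower (l.map Subtype.val) (by
    intro x hx
    rw [List.mem_map] at hx
    obtain ⟨y, hy, rfl⟩ := hx
    exact h2 y hy) T
  rw [List.length_map] at this
  convert this using 4
  rw [← h3, ← Subgroup.coe_subtype, map_list_prod]
end
end SPE

namespace SPE
section
variable {m : ℤ → ZMod 2}

lemma EL_bs (n : ℕ) (h : List BL → ℝ) : EL SL n (fun l => h (bs l)) = EL BL n h := by
  rw [split 0 n (fun _ l => h l)]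
  simp only [Esig_const]

/-- volume bound of the box -/
noncomputable def VV (m : ℤ → ZMod 2) (M : ℕ) : ℝ := (2 * M + 1) * 2 ^ kap m (2 * M)

lemma X_In (l : List SL) : Inn (Mx 0 (bs l)) (sw m l).g := by rw [sw_g]; exact bw_In _

lemma X_F (l : List SL) (x : XS m) (hx : (sw m l).F x ≠ 0) : x ∈ Box m (Mx 0 (bs l)) := by
  refine sites_Box _ x ?_
  by_contra h
  have h1 := F_le_count l x
  rw [List.count_eq_zero_of_not_mem h] at h1
  exact hx (abs_eq_zero.1 (le_antisymm (by simpa using h1) (abs_nonneg _)))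

lemma E_sq (n : ℕ) : EL SL n (fun l => ∑ x ∈ Box m (Mx 0 (bs l)), (((sw m l).F x : ℤ) : ℝ) ^ 2) = n := by
  rw [split m n (fun F l => ∑ x ∈ Box m (Mx 0 l), ((F x : ℤ) : ℝ) ^ 2)]
  rw [← EL_const (A := BL) n (n : ℝ)]
  refine EL_congr n fun l hl => ?_
  rw [Esig_sum]
  simp only [Esig_sq]
  rw [← Finset.sum_div, ← Nat.cast_sum, sum_count _ _ (sites_Box l), sites_length, hl]
  push_cast; ring

lemma E_four (n : ℕ) : EL SL n (fun l => ∑ x ∈ Box m (Mx 0 (bs l)), (((sw m l).F x : ℤ) : ℝ) ^ 4) ≤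
    3 / 4 * EL BL n (fun l => (npr (sites m l) : ℝ)) := by
  rw [split m n (fun F l => ∑ x ∈ Box m (Mx 0 l), ((F x : ℤ) : ℝ) ^ 4)]
  rw [← EL_mul_left]
  refine EL_mono n fun l hl => ?_
  rw [Esig_sum]
  refine (Finset.sum_le_sum fun x _ => Esig_four _ x).trans ?_
  rw [← Finset.mul_sum, ← sum_count_sq _ _ (sites_Box l)]
  push_cast; exact le_rfl

lemma speed_le (hm : ∀ s ≤ 0, m s = 0) (n : ℕ) (c : ℝ) (hc : 0 < c) :
    speed (SS m) (mu (sG m)) n ≤ (n / c + c * EL BL n (fun l => VV m (Mx 0 l))) / 2 +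
      EL BL n (fun l => (NN m (Mx 0 l) : ℝ) * (18 * Mx 0 l + 8) + (7 * Mx 0 l + 3)) := by
  rw [speed_eq]
  have h1 : ∀ l : List SL, (wordLength (SS m) (l.map (sG m)).prod : ℝ) ≤
      1 / (2 * c) * (∑ x ∈ Box m (Mx 0 (bs l)), (((sw m l).F x : ℤ) : ℝ) ^ 2) + (c / 2 * VV m (Mx 0 (bs l)) +
        ((NN m (Mx 0 (bs l)) : ℝ) * (18 * Mx 0 (bs l) + 8) + (7 * Mx 0 (bs l) + 3))) := by
    intro l
    set M := Mx 0 (bs l) with hM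
    have a1 := wl_le (m := m) (l.map (sG m)).prod _ (by
      rw [sG_prod]; exact Lw_main hm M (sw m l) (X_In l) (X_F l))
    have a2 : (wordLength (SS m) (l.map (sG m)).prod : ℝ) ≤
      ((∑ x ∈ Box m M, ((sw m l).F x).natAbs + NN m M * (18 * M + 8) + (7 * M + 3) : ℕ) : ℝ) := by
      exact_mod_cast a1
    push_cast at a2
    have a3 : ∑ x ∈ Box m M, ((((sw m l).F x).natAbs : ℕ) : ℝ) ≤
        ∑ x ∈ Box m M, (1 / (2 * c) * (((sw m l).F x : ℤ) : ℝ) ^ 2 + c / 2) := by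
      refine Finset.sum_le_sum fun x _ => ?_
      rw [Nat.cast_natAbs, Int.cast_abs]
      set y := |(((sw m l).F x : ℤ) : ℝ)| with hy
      rw [← sq_abs, ← hy]
      have : 1 / (2 * c) * y ^ 2 + c / 2 - y = (y - c) ^ 2 / (2 * c) := by field_simp; ring
      have : 0 ≤ (y - c) ^ 2 / (2 * c) := by positivity
      linarith
    rw [Finset.sum_add_distrib, ← Finset.mul_sum, Finset.sum_const, nsmul_eq_mul] at a3
    have a4 : ((Box m M).card : ℝ) ≤ VV m M := by unfold VV; exact_mod_cast Box_card hm M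
    have a5 : ((Box m M).card : ℝ) * (c / 2) ≤ c / 2 * VV m M := by
      rw [mul_comm]; gcongr
    linarith
  refine (EL_mono n fun l _ => h1 l).trans ?_
  rw [EL_add, EL_mul_left, E_sq]
  rw [EL_bs n (fun l => c / 2 * VV m (Mx 0 l) + ((NN m (Mx 0 l) : ℝ) * (18 * Mx 0 l + 8) + (7 * Mx 0 l + 3)))]
  rw [EL_add, EL_mul_left]
  apply le_of_eq
  generalize EL BL n (fun l => VV m (Mx 0 l)) = a
  generalize EL BL n (fun l => (NN m (Mx 0 l) : ℝ) * (18 * Mx 0 l + 8) + (7 * Mx 0 l + 3)) = b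
  field_simp
  ring

lemma speed_ge (hm : ∀ s ≤ 0, m s = 0) (n : ℕ) (M0 : ℝ) (hM0 : 0 < M0) :
    √M0 * (n / M0 - 3 / 16 * EL BL n (fun l => (npr (sites m l) : ℝ)) / M0 ^ 2) ≤
      speed (SS m) (mu (sG m)) n := by
  rw [speed_eq]
  have h1 : ∀ l : List SL, √M0 / M0 * (∑ x ∈ Box m (Mx 0 (bs l)), (((sw m l).F x : ℤ) : ℝ) ^ 2) +
      (-(√M0 / (4 * M0 ^ 2))) * (∑ x ∈ Box m (Mx 0 (bs l)), (((sw m l).F x : ℤ) : ℝ) ^ 4) ≤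
        (wordLength (SS m) (l.map (sG m)).prod : ℝ) := by
    intro l
    set M := Mx 0 (bs l) with hM
    have a1 := le_wl (m := m) (l.map (sG m)).prod ⟨_, by
      rw [sG_prod]; exact Lw_main hm M (sw m l) (X_In l) (X_F l)⟩ (Box m M)
    rw [sG_prod] at a1
    have a2 : ∑ x ∈ Box m M, ((((sw m l).F x).natAbs : ℕ) : ℝ) ≤
      (wordLength (SS m) (l.map (sG m)).prod : ℝ) := by exact_mod_cast a1
    refine le_trans ?_ a2
    rw [Finset.mul_sum, Finset.mul_sum, ← Finset.sum_add_distrib]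
    refine Finset.sum_le_sum fun x _ => ?_
    rw [Nat.cast_natAbs, Int.cast_abs]
    set y := |(((sw m l).F x : ℤ) : ℝ)| with hy
    have e2 : (((sw m l).F x : ℤ) : ℝ) ^ 2 = y ^ 2 := (sq_abs _).symm
    have e4 : (((sw m l).F x : ℤ) : ℝ) ^ 4 = y ^ 4 := by
      rw [show (4:ℕ) = 2 * 2 by norm_num, pow_mul, pow_mul, e2]
    rw [e2, e4]
    set q := √M0 with hq
    have hq0 : 0 < q := Real.sqrt_pos.2 hM0
    have hqq : M0 = q ^ 2 := (Real.sq_sqrt hM0.le).symm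
    rw [hqq]
    set w := y / q with hw
    have hyw : y = w * q := by rw [hw]; field_simp
    have hw0 : 0 ≤ w := by positivity
    rw [hyw]
    have : q / q ^ 2 * (w * q) ^ 2 + -(q / (4 * (q ^ 2) ^ 2)) * (w * q) ^ 4 = q * (w ^ 2 - w ^ 4 / 4) := by
      field_simp
      ring
    rw [this, mul_comm w q]
    refine mul_le_mul_of_nonneg_left ?_ hq0.le
    nlinarith [mul_nonneg hw0 (sq_nonneg (w - 6/5)), mul_nonneg (mul_nonneg hw0 hw0) (sq_nonneg (w-6/5)), mul_nonneg (mul_nonneg hw0 hw0) hw0]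
  refine le_trans ?_ (EL_mono n fun l _ => h1 l)
  rw [EL_add, EL_mul_left, EL_mul_left, E_sq]
  have h4 := E_four (m := m) n
  have h5 : 0 ≤ √M0 / (4 * M0 ^ 2) := by positivity
  have h6 := mul_le_mul_of_nonneg_left h4 h5
  have e : √M0 * (n / M0 - 3 / 16 * EL BL n (fun l => (npr (sites m l) : ℝ)) / M0 ^ 2) =
    √M0 / M0 * n - √M0 / (4 * M0 ^ 2) * (3 / 4 * EL BL n (fun l => (npr (sites m l) : ℝ))) := by
    field_simp
    ring
  rw [e]
  linarith

lemma log_lb (L M0 : ℝ) (hL : 0 ≤ L) (hM : 0 < M0) :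
    Real.log (1 + M0) * (L / M0 - L ^ 2 / M0 ^ 2) ≤ Real.log (1 + L) := by
  have hl : 0 ≤ Real.log (1 + L) := Real.log_nonneg (by linarith)
  have hl0 : 0 ≤ Real.log (1 + M0) := Real.log_nonneg (by linarith)
  set t := L / M0 with ht
  have ht0 : 0 ≤ t := by positivity
  have e : L ^ 2 / M0 ^ 2 = t ^ 2 := by rw [ht]; ring
  rw [e]
  by_cases h : t ≤ 1
  · have h1 := rpow_one_add_le_one_add_mul_self (show -1 ≤ M0 by linarith) ht0 h
    have h2 : t * M0 = L := by rw [ht]; field_simp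
    rw [h2] at h1
    have h3 := Real.log_le_log (by positivity) h1
    rw [Real.log_rpow (by linarith)] at h3
    nlinarith [mul_nonneg hl0 (sq_nonneg t)]
  · have : t - t ^ 2 ≤ 0 := by nlinarith
    nlinarith

lemma negMulLog_ge (q w : ℝ) (hq : 0 ≤ q) (h : q ≤ Real.exp (-w)) : q * w ≤ Real.negMulLog q := by
  rcases hq.eq_or_lt with rfl | hq
  · simp
  · have : Real.log q ≤ -w := by
      rw [← Real.log_exp (-w)]; exact Real.log_le_log hq h
    unfold Real.negMulLog
    nlinarith

lemma entropy_ge_aux (n : ℕ) : EL BL n (fun l => ∑ x ∈ Box m (Mx 0 l), Real.log (1 + (sites m l).count x) / 2) ≤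
    entropy (convPow (mu (sG m)) n) := by
  rw [entropy_eq]
  set w : List BL → ℝ := fun l => ∑ x ∈ Box m (Mx 0 l), Real.log (1 + (sites m l).count x) / 2 with hw
  set q : GG m → List BL → ℝ := fun g l => Esig (sites m l) (fun F => if F = g.val.F ∧ bw l = g.val.g then (1:ℝ) else 0) with hqd
  have hX : ∀ (g : GG m) (l : List SL), (l.map (sG m)).prod = g ↔ (sw m l).F = g.val.F ∧ bw (bs l) = g.val.g := by
    intro g l
    rw [← sw_g m, ← sG_prod]
    constructor
    · rintro rfl; exact ⟨rfl, rfl⟩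
    · rintro ⟨h1, h2⟩; exact Subtype.ext (PW.ext h1 h2)
  have hp : ∀ g : GG m, EL SL n (fun l => if (l.map (sG m)).prod = g then (1:ℝ) else 0) = EL BL n (q g) := by
    intro g
    rw [hqd, ← split m n (fun F l => if F = g.val.F ∧ bw l = g.val.g then (1:ℝ) else 0)]
    congr 1; funext l
    exact if_congr (hX g l) rfl rfl
  have hq0 : ∀ g l, 0 ≤ q g l := by
    intro g l
    have := Esig_mono (sites m l) (T := fun _ => 0) (U := fun F => if F = g.val.F ∧ bw l = g.val.g then (1:ℝ) else 0)
      (fun F => by split_ifs <;> norm_num)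
    rwa [Esig_const] at this
  have hqw : ∀ g l, q g l ≤ Real.exp (-(w l)) := by
    intro g l
    refine le_trans (Esig_mono _ fun F => ?_) (Esig_ind_bound (sites m l) g.val.F (Box m (Mx 0 l)) (sites_Box l))
    by_cases h : F = g.val.F
    · rw [if_pos h]; split_ifs <;> norm_num
    · rw [if_neg h, if_neg (fun hh => h hh.1)]
  have key : EL BL n w ≤ ∑ g ∈ PP (sG m) n, Real.negMulLog (EL SL n (fun l => if (l.map (sG m)).prod = g then (1:ℝ) else 0)) := by
   calc EL BL n w = EL SL n (fun l => w (bs l)) := (EL_bs n w).symm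
     _ = EL SL n (fun l => ∑ g ∈ PP (sG m) n, (if (l.map (sG m)).prod = g then (1:ℝ) else 0) * w (bs l)) := by
        refine EL_congr n fun l hl => ?_
        rw [← Finset.sum_mul, Finset.sum_ite_eq, if_pos (mem_PP (sG m) n l hl), one_mul]
     _ = ∑ g ∈ PP (sG m) n, EL BL n (fun l => q g l * w l) := by
        rw [EL_sum]
        refine Finset.sum_congr rfl fun g _ => ?_
        have := split m n (fun F l => w l * (if F = g.val.F ∧ bw l = g.val.g then (1:ℝ) else 0))
        simp only [Esig_mul_left] at this
        simp only [mul_comm (q g _)]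
        rw [hqd]
        refine Eq.trans ?_ this
        congr 1; funext l
        rw [mul_comm, if_congr (hX g l) rfl rfl]
     _ ≤ ∑ g ∈ PP (sG m) n, Real.negMulLog (EL SL n (fun l => if (l.map (sG m)).prod = g then (1:ℝ) else 0)) := by
        refine Finset.sum_le_sum fun g _ => ?_
        rw [hp]
        refine le_trans (EL_mono n fun l _ => ?_) (EL_jensen n (q g) (hq0 g))
        exact negMulLog_ge _ _ (hq0 g l) (hqw g l)
  convert key

lemma entropy_ge (n : ℕ) (M0 : ℝ) (hM : 0 < M0) :
    Real.log (1 + M0) / 2 * (2 * n / M0 - EL BL n (fun l => (npr (sites m l) : ℝ)) / M0 ^ 2) ≤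
    entropy (convPow (mu (sG m)) n) := by
  refine le_trans ?_ (entropy_ge_aux (m := m) n)
  have h1 : ∀ l : List BL, l.length = n → Real.log (1 + M0) / 2 * (2 * n / M0) +
      (-(Real.log (1 + M0) / 2 / M0 ^ 2)) * (npr (sites m l) : ℝ) ≤
      ∑ x ∈ Box m (Mx 0 l), Real.log (1 + (sites m l).count x) / 2 := by
    intro l hl
    have a1 := sum_count _ _ (sites_Box (m := m) l)
    have a2 := sum_count_sq _ _ (sites_Box (m := m) l)
    rw [sites_length, hl] at a1
    have b1 : ∑ x ∈ Box m (Mx 0 l), ((sites m l).count x : ℝ) = 2 * n := by exact_mod_cast a1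
    have b2 : ∑ x ∈ Box m (Mx 0 l), ((sites m l).count x : ℝ) ^ 2 = npr (sites m l) := by exact_mod_cast a2
    rw [← b1, ← b2]
    rw [Finset.sum_div, Finset.mul_sum, Finset.mul_sum, ← Finset.sum_add_distrib]
    refine Finset.sum_le_sum fun x _ => ?_
    have := log_lb ((sites m l).count x) M0 (by positivity) hM
    have e : Real.log (1 + M0) / 2 * (((sites m l).count x : ℝ) / M0) +
        -(Real.log (1 + M0) / 2 / M0 ^ 2) * ((sites m l).count x : ℝ) ^ 2 =
       (Real.log (1 + M0) * (((sites m l).count x : ℝ) / M0 - ((sites m l).count x : ℝ) ^ 2 / M0 ^ 2)) / 2 := by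
      field_simp
      ring
    rw [e]; linarith
  refine le_trans ?_ (EL_mono n h1)
  rw [EL_add, EL_const, EL_mul_left]
  apply le_of_eq
  ring

/-- the class of elements with parameter `M` -/
def InA (n M : ℕ) (g : PW m) : Prop :=
  Inn M g.g ∧ (∀ x, g.F x ≠ 0 → x ∈ Box m M) ∧ ∀ x, (g.F x).natAbs ≤ 2 * n

lemma X_InA (l : List SL) (n : ℕ) (hl : l.length = n) : InA n (Mx 0 (bs l)) (sw m l) := by
  refine ⟨X_In l, X_F l, fun x => ?_⟩
  have h1 := F_le_count (m := m) l x
  have h2 := List.count_le_length (a := x) (l := sites m (bs l))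
  rw [sites_length, bs_length, hl] at h2
  rw [Int.abs_eq_natAbs] at h1
  omega

lemma InA_card (n M : ℕ) (P : Finset (PW m)) (hP : ∀ g ∈ P, InA n M g) :
    P.card ≤ (4 * n + 1) ^ (Box m M).card * (2 ^ (2 * M + 1) * (2 * M + 1)) := by
  have e : Fintype.card ((Box m M → Finset.Icc (-(2 * n : ℤ)) (2 * n)) × (Finset.Icc (-(M:ℤ)) M → ZMod 2) × Finset.Icc (-(M:ℤ)) M)
     = (4 * n + 1) ^ (Box m M).card * (2 ^ (2 * M + 1) * (2 * M + 1)) := by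
    rw [Fintype.card_prod, Fintype.card_prod, Fintype.card_fun, Fintype.card_fun, ZMod.card]
    simp only [Fintype.card_coe, Int.card_Icc]
    congr 2
    · omega
    · congr 1; omega
    · omega
  rw [← e, ← Finset.card_univ]
  by_cases hP0 : P = ∅
  · rw [hP0]; simp
  refine Finset.card_le_card_of_injOn (fun g => (fun x => ⟨max (-(2*n:ℤ)) (min (2 * n) (g.F x)), by
      rw [Finset.mem_Icc]; omega⟩, fun i => g.g.φ i, ⟨max (-(M:ℤ)) (min M g.g.z), by rw [Finset.mem_Icc]; omega⟩))
    (fun _ _ => Finset.mem_coe.2 (Finset.mem_univ _)) ?_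
  intro g hg g' hg' h
  obtain ⟨⟨a1, a2⟩, a3, a4⟩ := hP g hg
  obtain ⟨⟨b1, b2⟩, b3, b4⟩ := hP g' hg'
  simp only [Prod.mk.injEq, Subtype.mk.injEq] at h
  obtain ⟨h1, h2, h3⟩ := h
  refine PW.ext ?_ (Lm.ext ?_ ?_)
  · funext x
    by_cases hx : x ∈ Box m M
    · have := congrArg Subtype.val (congrFun h1 ⟨x, hx⟩)
      simp only at this
      have := a4 x
      have := b4 x
      omega
    · have c1 : g.F x = 0 := by by_contra hh; exact hx (a3 x hh)
      have c2 : g'.F x = 0 := by by_contra hh; exact hx (b3 x hh)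
      rw [c1, c2]
  · funext i
    by_cases hi : M < i.natAbs
    · rw [a2 i hi, b2 i hi]
    · exact congrFun h2 ⟨i, by rw [Finset.mem_Icc]; omega⟩
  · omega

lemma sum_inv_sq (N : ℕ) : ∑ k ∈ Finset.range N, 1 / ((k:ℝ) + 1) ^ 2 ≤ 2 - 1 / ((N:ℝ) + 1 / 2) := by
  induction N with
  | zero => norm_num
  | succ N ih =>
    rw [Finset.sum_range_succ]
    have : 1 / ((N:ℝ) + 1) ^ 2 ≤ 1 / ((N:ℝ) + 1 / 2) - 1 / (((N + 1 : ℕ):ℝ) + 1 / 2) := by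
      push_cast
      rw [div_sub_div _ _ (by positivity) (by positivity), div_le_div_iff₀ (by positivity) (by positivity)]
      nlinarith
    linarith

lemma kap_mono : Monotone (kap m) := monotone_nat_of_le_succ fun d => by rw [kap_succ]; omega
lemma VV_mono : Monotone (VV m) := by
  intro a b h
  unfold VV
  have : kap m (2 * a) ≤ kap m (2 * b) := kap_mono (by omega)
  have : (2:ℝ) ^ kap m (2 * a) ≤ 2 ^ kap m (2 * b) := pow_le_pow_right₀ (by norm_num) this
  have : (a:ℝ) ≤ b := by exact_mod_cast h
  gcongr

/-- code length -/
noncomputable def cl (m : ℤ → ZMod 2) (n M : ℕ) : ℝ :=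
  VV m M * Real.log (4 * n + 1) + ((2 * M + 1) * Real.log 2 + Real.log (2 * M + 1)) + 2 * Real.log (M + 1)

lemma cl_mono (n : ℕ) : Monotone (cl m n) := by
  intro a b h
  unfold cl
  have h1 := VV_mono (m := m) h
  have h2 : (a:ℝ) ≤ b := by exact_mod_cast h
  have h3 : 0 ≤ Real.log (4 * n + 1) := Real.log_nonneg (by have : (0:ℝ) ≤ n := by positivity
                                                            linarith)
  have h4 : 0 ≤ Real.log 2 := Real.log_nonneg (by norm_num)
  gcongr

lemma entropy_up (hm : ∀ s ≤ 0, m s = 0) (n : ℕ) (hn : 1 ≤ n) : entropy (convPow (mu (sG m)) n) ≤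
    13 * Real.log (n + 1) * EL BL n (fun l => VV m (Mx 0 l)) := by
  set Mg : GG m → ℕ := fun g => sInf {M | InA n M g.val} with hMg
  refine (entropy_le (sG m) n (fun g => cl m n (Mg g))).trans ?_
  have hMl : ∀ l : List SL, l.length = n → Mg (l.map (sG m)).prod ≤ Mx 0 (bs l) := by
    intro l hl
    refine Nat.sInf_le ?_
    show InA n _ _
    rw [sG_prod]; exact X_InA l n hl
  have hin : ∀ g ∈ PP (sG m) n, InA n (Mg g) g.val := by
    intro g hg
    refine Nat.sInf_mem (s := {M | InA n M g.val}) ?_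
    obtain ⟨l, hl, rfl⟩ := mem_PP_iff _ _ _ hg
    refine ⟨Mx 0 (bs l), ?_⟩
    show InA n _ _
    rw [sG_prod]; exact X_InA l n hl
  have hL : (1:ℝ) / 2 ≤ Real.log (n + 1) := by
    have h1 := Real.log_two_gt_d9
    have h2 : Real.log 2 ≤ Real.log (n + 1) := Real.log_le_log (by norm_num) (by
      have : (1:ℝ) ≤ n := by exact_mod_cast hn
      linarith)
    linarith
  have hcl : ∀ M, cl m n M ≤ 9 * Real.log (n + 1) * VV m M := by
    intro M
    have hn1 : (1:ℝ) ≤ n := by exact_mod_cast hn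
    have h1 : Real.log (4 * n + 1) ≤ 3 * Real.log (n + 1) := by
      have : Real.log ((n + 1 : ℝ) ^ 3) = 3 * Real.log (n + 1) := by rw [Real.log_pow]; norm_num
      rw [← this]
      exact Real.log_le_log (by positivity) (by
        have e : ((n:ℝ) + 1) ^ 3 = n ^ 3 + 3 * (n * n) + 3 * n + 1 := by ring
        have h3 : (0:ℝ) ≤ (n:ℝ) ^ 3 := by positivity
        nlinarith)
    have hQ : (1:ℝ) ≤ 2 ^ kap m (2 * M) := one_le_pow₀ (by norm_num)
    have hV : (2 * M + 1 : ℝ) ≤ VV m M := by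
      unfold VV; nlinarith [show (0:ℝ) ≤ M by positivity]
    have h2 : Real.log 2 ≤ 1 := by linarith [Real.log_two_lt_d9]
    have h3 : Real.log (2 * M + 1) ≤ 2 * M + 1 - 1 := Real.log_le_sub_one_of_pos (by positivity)
    have h4 : Real.log (M + 1) ≤ M + 1 - 1 := Real.log_le_sub_one_of_pos (by positivity)
    have hM0 : (0:ℝ) ≤ M := by positivity
    have h5 : VV m M * Real.log (4 * n + 1) ≤ VV m M * (3 * Real.log (n + 1)) := by
      gcongr; linarith
    have h6 : (2 * (M:ℝ) + 1) * Real.log 2 ≤ 2 * M + 1 := by nlinarith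
    have h7 : VV m M ≤ VV m M * (2 * Real.log (n + 1)) := by nlinarith
    unfold cl
    nlinarith
  have hE : EL SL n (fun l => cl m n (Mg (l.map (sG m)).prod)) ≤
      9 * Real.log (n + 1) * EL BL n (fun l => VV m (Mx 0 l)) := by
    rw [← EL_mul_left, ← EL_bs]
    refine EL_mono n fun l hl => ?_
    exact (cl_mono n (hMl l hl)).trans (hcl _)
  have hS : ∑ g ∈ PP (sG m) n, Real.exp (-(cl m n (Mg g))) ≤ 2 := by
    obtain ⟨N, hN⟩ : ∃ N, ∀ g ∈ PP (sG m) n, Mg g ∈ Finset.range N := by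
      obtain ⟨N, hN⟩ := ((PP (sG m) n).image Mg).bddAbove
      exact ⟨N + 1, fun g hg => Finset.mem_range.2 (Nat.lt_succ_of_le (hN (Finset.mem_coe.2 (Finset.mem_image_of_mem _ hg))))⟩
    rw [← Finset.sum_fiberwise_of_maps_to hN]
    have : ∀ M ∈ Finset.range N, ∑ g ∈ PP (sG m) n with Mg g = M, Real.exp (-(cl m n (Mg g))) ≤ 1 / ((M:ℝ) + 1) ^ 2 := by
      intro M _
      have a1 : ∑ g ∈ PP (sG m) n with Mg g = M, Real.exp (-(cl m n (Mg g))) =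
          ((PP (sG m) n).filter (fun g => Mg g = M)).card * Real.exp (-(cl m n M)) := by
        rw [← nsmul_eq_mul, ← Finset.sum_const]
        refine Finset.sum_congr rfl fun g hg => ?_
        rw [(Finset.mem_filter.1 hg).2]
      rw [a1]
      have a2 := InA_card (m := m) n M (((PP (sG m) n).filter (fun g => Mg g = M)).image Subtype.val) (by
        intro g hg
        rw [Finset.mem_image] at hg
        obtain ⟨g', hg', rfl⟩ := hg
        rw [Finset.mem_filter] at hg'
        rw [← hg'.2]; exact hin _ hg'.1)
      rw [Finset.card_image_of_injective _ Subtype.val_injective] at a2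
      have a3 : (((PP (sG m) n).filter (fun g => Mg g = M)).card : ℝ) ≤
        (4 * n + 1) ^ (Box m M).card * (2 ^ (2 * M + 1) * (2 * M + 1)) := by exact_mod_cast a2
      have a4 : ((Box m M).card : ℝ) ≤ VV m M := by unfold VV; exact_mod_cast Box_card hm M
      have hl4 : 0 ≤ Real.log (4 * n + 1) := Real.log_nonneg (by
        have : (0:ℝ) ≤ n := by positivity
        linarith)
      have a5 : ((4 * n + 1 : ℝ)) ^ (Box m M).card ≤ Real.exp (VV m M * Real.log (4 * n + 1)) := by
        rw [← Real.exp_log (show (0:ℝ) < 4 * n + 1 by positivity), ← Real.exp_nat_mul, Real.exp_le_exp, Real.log_exp]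
        gcongr
      have a6 : (2:ℝ) ^ (2 * M + 1) * (2 * M + 1) = Real.exp ((2 * M + 1) * Real.log 2 + Real.log (2 * M + 1)) := by
        rw [Real.exp_add, Real.exp_log (by positivity)]
        congr 1
        have := Real.exp_nat_mul (Real.log 2) (2 * M + 1)
        rw [Real.exp_log (by norm_num)] at this
        rw [← this]; push_cast; rfl
      have a7 : Real.exp (2 * Real.log (M + 1)) = ((M:ℝ) + 1) ^ 2 := by
        have := Real.exp_nat_mul (Real.log (M + 1)) 2
        rw [Real.exp_log (by positivity)] at this
        rw [← this]; push_cast; rfl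
      have a8 : (((PP (sG m) n).filter (fun g => Mg g = M)).card : ℝ) ≤
          Real.exp (VV m M * Real.log (4 * n + 1) + ((2 * M + 1) * Real.log 2 + Real.log (2 * M + 1))) := by
        rw [Real.exp_add, ← a6]
        refine a3.trans ?_
        gcongr
      have a9 : Real.exp (-(cl m n M)) = (Real.exp (VV m M * Real.log (4 * n + 1) + ((2 * M + 1) * Real.log 2 + Real.log (2 * M + 1))))⁻¹ * (((M:ℝ) + 1) ^ 2)⁻¹ := by
        rw [← a7, ← Real.exp_neg, ← Real.exp_neg, ← Real.exp_add]
        congr 1; unfold cl; ring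
      rw [a9, ← mul_assoc, one_div]
      refine mul_le_of_le_one_left (by positivity) ?_
      rw [← div_eq_mul_inv, div_le_one (Real.exp_pos _)]
      exact a8
    refine (Finset.sum_le_sum this).trans ((sum_inv_sq N).trans ?_)
    have : (0:ℝ) ≤ 1 / ((N:ℝ) + 1 / 2) := by positivity
    linarith
  have hV1 : (1:ℝ) ≤ EL BL n (fun l => VV m (Mx 0 l)) := by
    rw [← EL_const (A := BL) n (1:ℝ)]
    refine EL_mono n fun l _ => ?_
    have hQ : (1:ℝ) ≤ 2 ^ kap m (2 * (Mx 0 l)) := one_le_pow₀ (by norm_num)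
    unfold VV; nlinarith [show (0:ℝ) ≤ (Mx 0 l : ℝ) by positivity]
  nlinarith
end
end SPE

namespace SPE

/-- admissible profile -/
structure Prof (β : ℝ) (h : ℝ → ℝ) : Prop where
  b0 : 0 ≤ β
  b1 : β < 1
  one : h 1 = 1
  pos : ∀ x, 1 ≤ x → 0 < h x
  lip : ∀ a x, 1 ≤ a → 1 ≤ x → h x ≤ h (a * x) ∧ h (a * x) ≤ a ^ β * h x

namespace Prof
variable {β : ℝ} {h : ℝ → ℝ}

lemma mono (H : Prof β h) {x y : ℝ} (hx : 1 ≤ x) (hxy : x ≤ y) : h x ≤ h y := by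
  have := (H.lip (y / x) x (by rw [le_div_iff₀ (by linarith)]; linarith) hx).1
  rwa [div_mul_cancel₀ _ (by linarith)] at this

lemma up (H : Prof β h) {x y : ℝ} (hx : 1 ≤ x) (hxy : x ≤ y) : h y ≤ (y / x) ^ β * h x := by
  have := (H.lip (y / x) x (by rw [le_div_iff₀ (by linarith)]; linarith) hx).2
  rwa [div_mul_cancel₀ _ (by linarith)] at this

lemma up1 (H : Prof β h) {x y : ℝ} (hx : 1 ≤ x) (hxy : x ≤ y) : h y ≤ (y / x) * h x := by
  refine (H.up hx hxy).trans ?_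
  have h1 : 1 ≤ y / x := by rw [le_div_iff₀ (by linarith)]; linarith
  have : (y / x) ^ β ≤ (y / x) ^ (1:ℝ) := Real.rpow_le_rpow_of_exponent_le h1 H.b1.le
  rw [Real.rpow_one] at this
  exact mul_le_mul_of_nonneg_right this (H.pos x hx).le

lemma dbl (H : Prof β h) {x y : ℝ} (hx : 1 ≤ x) (hxy : x ≤ y) (hy : y ≤ 2 * x) : h y ≤ 2 * h x := by
  refine (H.up1 hx hxy).trans ?_
  have h1 : y / x ≤ 2 := by rw [div_le_iff₀ (by linarith)]; linarith
  exact mul_le_mul_of_nonneg_right h1 (H.pos x hx).le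

lemma ge1 (H : Prof β h) {x : ℝ} (hx : 1 ≤ x) : 1 ≤ h x := by
  rw [← H.one]; exact H.mono le_rfl hx

lemma le_rpow (H : Prof β h) {x : ℝ} (hx : 1 ≤ x) : h x ≤ x ^ β := by
  have := H.up le_rfl hx
  rwa [H.one, div_one, mul_one] at this

lemma le_aff (H : Prof β h) {x r : ℝ} (hx : 1 ≤ x) (hr : 1 ≤ r) : h x ≤ (1 + x / r) * h r := by
  have h0 := (H.pos r hr).le
  have h1 : 0 ≤ x / r := by positivity
  rcases le_total x r with hh | hh
  · have := H.mono hx hh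
    nlinarith
  · have := H.up1 hr hh
    nlinarith

/-- dyadic exponent -/
noncomputable def K (h : ℝ → ℝ) (d : ℕ) : ℕ := Nat.log 2 ⌊h d⌋₊

lemma K_le (H : Prof β h) (d : ℕ) (hd : 1 ≤ d) : (2:ℝ) ^ K h d ≤ h d := by
  have h1 : 1 ≤ h d := H.ge1 (by exact_mod_cast hd)
  have h2 : ⌊h d⌋₊ ≠ 0 := by
    have := (Nat.one_le_floor_iff (h d)).2 h1
    omega
  have h3 : 2 ^ K h d ≤ ⌊h d⌋₊ := Nat.pow_log_le_self 2 h2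
  have h4 : ((2 ^ K h d : ℕ) : ℝ) ≤ h d := (Nat.le_floor_iff (by linarith)).1 h3
  exact_mod_cast h4

lemma lt_K (H : Prof β h) (d : ℕ) (hd : 1 ≤ d) : h d < 2 * (2:ℝ) ^ K h d := by
  have h1 : 1 ≤ h d := H.ge1 (by exact_mod_cast hd)
  have h3 : ⌊h d⌋₊ < 2 ^ (K h d + 1) := Nat.lt_pow_succ_log_self (by norm_num) _
  have h4 : h d < ((2 ^ (K h d + 1) : ℕ) : ℝ) := (Nat.floor_lt (by linarith)).1 h3
  push_cast at h4
  rw [pow_succ] at h4; linarith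

lemma K_mono (H : Prof β h) (d : ℕ) (hd : 1 ≤ d) : K h d ≤ K h (d + 1) := by
  have h1 : (1:ℝ) ≤ d := by exact_mod_cast hd
  exact Nat.log_mono_right (Nat.floor_mono (H.mono h1 (by push_cast; linarith)))

lemma K_succ_le (H : Prof β h) (d : ℕ) (hd : 1 ≤ d) : K h (d + 1) ≤ K h d + 1 := by
  have h1 : (1:ℝ) ≤ d := by exact_mod_cast hd
  have a := H.K_le (d + 1) (by omega)
  have b := H.dbl (y := ((d + 1 : ℕ) : ℝ)) h1 (by push_cast; linarith) (by push_cast; linarith)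
  have c := H.lt_K d hd
  have : (2:ℝ) ^ K h (d + 1) < 2 ^ (K h d + 2) := by rw [pow_add]; linarith
  have := (pow_lt_pow_iff_right₀ (by norm_num : (1:ℝ) < 2)).1 this
  omega

lemma mask (H : Prof β h) : ∃ m : ℤ → ZMod 2, (∀ s ≤ 0, m s = 0) ∧
    ∀ d : ℕ, 1 ≤ d → (2:ℝ) ^ kap m d ≤ h d ∧ h d ≤ 2 * (2:ℝ) ^ kap m d := by
  set m : ℤ → ZMod 2 := fun s => if 2 ≤ s ∧ K h s.toNat ≠ K h (s.toNat - 1) then 1 else 0 with hm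
  have hk : ∀ d : ℕ, kap m (d + 1) = K h (d + 1) := by
    intro d
    induction d with
    | zero =>
      rw [kap_succ]
      have : m ((0 + 1 : ℕ) : ℤ) = 0 := by rw [hm]; simp
      rw [this]
      have h2 : K h (0 + 1) = 0 := by simp [K, H.one]
      rw [h2]
      simp [kap]
    | succ d ih =>
      rw [kap_succ, ih]
      have e : m ((d + 1 + 1 : ℕ) : ℤ) = if K h (d + 1 + 1) ≠ K h (d + 1) then 1 else 0 := by
        rw [hm]
        have e1 : ((d + 1 + 1 : ℕ) : ℤ).toNat = d + 1 + 1 := Int.toNat_natCast _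
        have e2 : (2:ℤ) ≤ ((d + 1 + 1 : ℕ) : ℤ) := by push_cast; omega
        simp only [e1, e2, true_and]
        rfl
      rw [e]
      have a := H.K_mono (d + 1) (by omega)
      have b := H.K_succ_le (d + 1) (by omega)
      by_cases hh : K h (d + 1 + 1) = K h (d + 1)
      · simp [hh]
      · simp only [ne_eq, hh, not_false_eq_true, if_true]
        omega
  refine ⟨m, fun s hs => ?_, fun d hd => ?_⟩
  · rw [hm]; simp only; rw [if_neg]; omega
  · obtain ⟨e, rfl⟩ : ∃ e, d = e + 1 := ⟨d - 1, by omega⟩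
    rw [hk]
    exact ⟨H.K_le _ hd, (H.lt_K _ hd).le⟩

end Prof

lemma sum_rpow (β : ℝ) (h0 : 0 ≤ β) (h1 : β < 1) (D : ℕ) :
    ∑ k ∈ Finset.range D, ((k:ℝ) + 1) ^ (-β) ≤ (D:ℝ) ^ (1 - β) / (1 - β) := by
  rw [le_div_iff₀ (by linarith)]
  induction D with
  | zero => simp; positivity
  | succ D ih =>
    rw [Finset.sum_range_succ, add_mul]
    have hD : (0:ℝ) < (D:ℝ) + 1 := by positivity
    set x : ℝ := (D:ℝ) + 1 with hx
    have hx1 : 1 ≤ x := by have : (0:ℝ) ≤ D := by positivity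
                           linarith
    have a := rpow_one_add_le_one_add_mul_self (s := -(1 / x)) (p := 1 - β)
      (by have : 1 / x ≤ 1 := by rw [div_le_one hD]; exact hx1
          linarith) (by linarith) (by linarith)
    have e1 : (D:ℝ) = x * (1 + -(1 / x)) := by field_simp; linarith
    have hnn : 0 ≤ 1 + -(1 / x) := by
      have : 1 / x ≤ 1 := by rw [div_le_one hD]; exact hx1
      linarith
    have e2 : (D:ℝ) ^ (1 - β) ≤ x ^ (1 - β) * (1 + (1 - β) * -(1 / x)) := by
      rw [e1, Real.mul_rpow hD.le hnn]
      exact mul_le_mul_of_nonneg_left a (by positivity)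
    have e3 : x ^ (1 - β) = x * x ^ (-β) := by
      rw [sub_eq_add_neg, Real.rpow_add hD, Real.rpow_one]
    have e4 : x ^ (1 - β) * (1 + (1 - β) * -(1 / x)) = x ^ (1 - β) - x ^ (-β) * (1 - β) := by
      rw [e3]; field_simp; ring
    have e5 : ((D + 1 : ℕ) : ℝ) = x := by push_cast; rfl
    rw [e5]
    linarith

section
variable {β : ℝ} {h : ℝ → ℝ} {m : ℤ → ZMod 2}

lemma ww_eq (k : ℕ) : ww m k = 1 / (2:ℝ) ^ kap m k := by unfold ww; rw [one_div_pow]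

lemma pairs (H : Prof β h)
    (hk : ∀ d : ℕ, 1 ≤ d → (2:ℝ) ^ kap m d ≤ h d ∧ h d ≤ 2 * (2:ℝ) ^ kap m d)
    (n : ℕ) (hn : 1 ≤ n) (r : ℝ) (hr1 : 1 ≤ r) (hr : r ^ 2 = n) :
    EL BL n (fun l => (npr (sites m l) : ℝ)) ≤ 112 / (1 - β) * (n * (r / h r)) := by
  set D := ⌊r⌋₊ with hD
  have hD1 : 1 ≤ D := (Nat.one_le_floor_iff r).2 hr1
  have hD1' : (1:ℝ) ≤ D := by exact_mod_cast hD1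
  have hDr : (D:ℝ) ≤ r := Nat.floor_le (by linarith)
  have hrD : r < D + 1 := Nat.lt_floor_add_one r
  have hb : 0 < 1 - β := by linarith [H.b1]
  have hhr := H.pos r hr1
  have hww : ∀ k : ℕ, ww m k ≤ 4 / h ((k:ℝ) + 1) := by
    intro k
    have hk0 : (0:ℝ) ≤ k := by positivity
    have hp := H.pos ((k:ℝ) + 1) (by linarith)
    rw [ww_eq, div_le_div_iff₀ (by positivity) hp, one_mul]
    rcases Nat.eq_zero_or_pos k with rfl | hkp
    · simp only [Nat.cast_zero, zero_add, H.one]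
      have : (1:ℝ) ≤ 2 ^ kap m 0 := one_le_pow₀ (by norm_num)
      linarith
    · have hk1 : (1:ℝ) ≤ k := by exact_mod_cast hkp
      have a := H.dbl (y := (k:ℝ) + 1) hk1 (by linarith) (by linarith)
      have b := (hk k hkp).2
      linarith
  have hwk : ∀ k ∈ Finset.range D, ww m k ≤ 4 * r ^ β / h r * ((k:ℝ) + 1) ^ (-β) := by
    intro k hkD
    have hkD' : (k:ℝ) + 1 ≤ D := by exact_mod_cast Finset.mem_range.1 hkD
    have hk0 : (0:ℝ) ≤ k := by positivity
    refine (hww k).trans ?_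
    have hp := H.pos ((k:ℝ) + 1) (by linarith)
    have a := H.up (x := (k:ℝ) + 1) (y := r) (by linarith) (by linarith)
    rw [Real.div_rpow (by linarith) (by linarith)] at a
    rw [Real.rpow_neg (by linarith), div_le_iff₀ hp]
    have hq : 0 < ((k:ℝ) + 1) ^ β := by positivity
    have e : 4 * r ^ β / h r * (((k:ℝ) + 1) ^ β)⁻¹ * h ((k:ℝ) + 1) =
      4 * ((r ^ β / ((k:ℝ) + 1) ^ β * h ((k:ℝ) + 1)) / h r) := by
      field_simp
    rw [e]
    have : 1 ≤ (r ^ β / ((k:ℝ) + 1) ^ β * h ((k:ℝ) + 1)) / h r := by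
      rw [le_div_iff₀ hhr, one_mul]; exact a
    linarith
  have hs : ∑ k ∈ Finset.range D, ww m k ≤ 4 / (1 - β) * (r / h r) := by
    refine (Finset.sum_le_sum hwk).trans ?_
    rw [← Finset.mul_sum]
    have a := sum_rpow β H.b0 H.b1 D
    have b : (D:ℝ) ^ (1 - β) ≤ r ^ (1 - β) := Real.rpow_le_rpow (by positivity) hDr hb.le
    have c : r ^ β * r ^ (1 - β) = r := by
      rw [← Real.rpow_add (by linarith)]; simp
    calc 4 * r ^ β / h r * ∑ k ∈ Finset.range D, ((k:ℝ) + 1) ^ (-β)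
        ≤ 4 * r ^ β / h r * (r ^ (1 - β) / (1 - β)) := by
          refine mul_le_mul_of_nonneg_left ?_ (by positivity)
          refine a.trans ?_
          gcongr
      _ = 4 / (1 - β) * ((r ^ β * r ^ (1 - β)) / h r) := by field_simp
      _ = _ := by rw [c]
  have hwD : ww m D ≤ 4 / h r := by
    have a := H.dbl (x := D) (y := r) hD1' hDr (by linarith)
    have b := (hk D hD1).2
    rw [ww_eq, div_le_div_iff₀ (by positivity) hhr, one_mul]
    linarith
  have hn' : (1:ℝ) ≤ n := by exact_mod_cast hn
  have hc : (r + (n + 1) / r) / 2 ≤ 3 / 2 * r := by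
    have : ((n:ℝ) + 1) / r ≤ 2 * r := by
      rw [div_le_iff₀ (by linarith)]; nlinarith
    linarith
  have hw2 : ww m D * ((r + (n + 1) / r) / 2) ≤ 6 * (r / h r) := by
    calc ww m D * ((r + (n + 1) / r) / 2) ≤ 4 / h r * (3 / 2 * r) := by
          have : 0 ≤ (r + ((n:ℝ) + 1) / r) / 2 := by positivity
          exact mul_le_mul hwD hc this (by positivity)
      _ = _ := by field_simp; ring
  have hT : 0 < r / h r := by positivity
  have h14 : 2 * (4 / (1 - β) * (r / h r)) + 6 * (r / h r) ≤ 14 / (1 - β) * (r / h r) := by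
    have : 6 ≤ 6 / (1 - β) := by rw [le_div_iff₀ hb]; linarith [H.b0]
    have e : 14 / (1 - β) = 2 * (4 / (1 - β)) + 6 / (1 - β) := by field_simp; ring
    rw [e]; nlinarith
  refine (E_npr m n D r (by linarith)).trans ?_
  calc 8 * (n:ℝ) * (2 * ∑ k ∈ Finset.range D, ww m k + ww m D * ((r + (n + 1) / r) / 2))
      ≤ 8 * (n:ℝ) * (14 / (1 - β) * (r / h r)) := by
        refine mul_le_mul_of_nonneg_left ?_ (by positivity)
        linarith
    _ = _ := by field_simp; ring

/-- bound on the dyadic value -/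
lemma Q_le (H : Prof β h)
    (hk : ∀ d : ℕ, 1 ≤ d → (2:ℝ) ^ kap m d ≤ h d ∧ h d ≤ 2 * (2:ℝ) ^ kap m d)
    (M : ℕ) (r : ℝ) (hr1 : 1 ≤ r) : (2:ℝ) ^ kap m (2 * M) ≤ (1 + 2 * M / r) * h r := by
  rcases Nat.eq_zero_or_pos M with rfl | hM
  · have : kap m (2 * 0) = 0 := by simp [kap]
    rw [this]; simpa using H.ge1 hr1
  · have a := (hk (2 * M) (by omega)).1
    have hM' : (1:ℝ) ≤ M := by exact_mod_cast hM
    have b := H.le_aff (x := ((2 * M : ℕ) : ℝ)) (by push_cast; linarith) hr1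
    refine a.trans (b.trans (le_of_eq ?_))
    push_cast; ring

lemma Q_le' (H : Prof β h)
    (hk : ∀ d : ℕ, 1 ≤ d → (2:ℝ) ^ kap m d ≤ h d ∧ h d ≤ 2 * (2:ℝ) ^ kap m d)
    (M : ℕ) : (2:ℝ) ^ kap m (2 * M) ≤ (2 * M + 1 : ℝ) ^ β := by
  have hM0 : (0:ℝ) ≤ M := by positivity
  rcases Nat.eq_zero_or_pos M with rfl | hM
  · have : kap m (2 * 0) = 0 := by simp [kap]
    rw [this]; simp
  · have a := (hk (2 * M) (by omega)).1
    have hM' : (1:ℝ) ≤ M := by exact_mod_cast hM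
    have b := H.le_rpow (x := ((2 * M : ℕ) : ℝ)) (by push_cast; linarith)
    refine a.trans (b.trans ?_)
    push_cast
    exact Real.rpow_le_rpow (by positivity) (by linarith) H.b0

lemma u_bd (n : ℕ) (hn : 1 ≤ n) (r : ℝ) (hr1 : 1 ≤ r) (hr : r ^ 2 = n) :
    EL BL n (fun l => (1 + 2 * (Mx 0 l : ℝ) / r) ^ 2) ≤ 34 := by
  have hn' : (0:ℝ) < n := by exact_mod_cast hn
  have : ∀ l : List BL, (1 + 2 * (Mx 0 l : ℝ) / r) ^ 2 ≤ 2 + 8 / n * (Mx 0 l : ℝ) ^ 2 := by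
    intro l
    rw [← hr]
    set t := (Mx 0 l : ℝ) / r with ht
    have e1 : 2 * (Mx 0 l : ℝ) / r = 2 * t := by rw [ht]; ring
    have e2 : 8 / r ^ 2 * (Mx 0 l : ℝ) ^ 2 = 8 * t ^ 2 := by rw [ht]; ring
    rw [e1, e2]; nlinarith [sq_nonneg (1 - 2 * t)]
  refine (EL_mono n fun l _ => this l).trans ?_
  rw [EL_add, EL_const, EL_mul_left]
  have a := E_Mx_sq n
  have b : 8 / (n:ℝ) * EL BL n (fun l => (Mx 0 l : ℝ) ^ 2) ≤ 8 / n * (4 * n) := by gcongr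
  have c : 8 / (n:ℝ) * (4 * n) = 32 := by field_simp; norm_num
  linarith

lemma VV_bd (H : Prof β h)
    (hk : ∀ d : ℕ, 1 ≤ d → (2:ℝ) ^ kap m d ≤ h d ∧ h d ≤ 2 * (2:ℝ) ^ kap m d)
    (n : ℕ) (hn : 1 ≤ n) (r : ℝ) (hr1 : 1 ≤ r) (hr : r ^ 2 = n) :
    EL BL n (fun l => VV m (Mx 0 l)) ≤ 34 * (r * h r) := by
  have hh := H.pos r hr1
  have : ∀ l : List BL, VV m (Mx 0 l) ≤ (r * h r) * (1 + 2 * (Mx 0 l : ℝ) / r) ^ 2 := by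
    intro l
    unfold VV
    have a := Q_le H hk (Mx 0 l) r hr1
    have b : 2 * (Mx 0 l : ℝ) + 1 ≤ r * (1 + 2 * (Mx 0 l : ℝ) / r) := by
      have : r * (1 + 2 * (Mx 0 l : ℝ) / r) = r + 2 * (Mx 0 l : ℝ) := by field_simp
      rw [this]; linarith
    calc _ ≤ (r * (1 + 2 * (Mx 0 l : ℝ) / r)) * ((1 + 2 * (Mx 0 l : ℝ) / r) * h r) := by
            exact mul_le_mul b a (by positivity) (by positivity)
      _ = _ := by ring
  refine (EL_mono n fun l _ => this l).trans ?_
  rw [EL_mul_left]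
  have := u_bd n hn r hr1 hr
  nlinarith [mul_pos (show 0 < r by linarith) hh]

lemma NN_bd (H : Prof β h)
    (hk : ∀ d : ℕ, 1 ≤ d → (2:ℝ) ^ kap m d ≤ h d ∧ h d ≤ 2 * (2:ℝ) ^ kap m d)
    (M : ℕ) (r : ℝ) (hr1 : 1 ≤ r) :
    (NN m M : ℝ) * (18 * M + 8) + (7 * M + 3) ≤
      (36 / (1 - β) + 13) * (r * √(r * h r)) * (1 + 2 * M / r) ^ 2 := by
  have hh := H.pos r hr1
  have hb : 0 < 1 - β := by linarith [H.b1]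
  have hM0 : (0:ℝ) ≤ M := by positivity
  set Q : ℝ := 2 ^ kap m (2 * M) with hQ
  set x : ℝ := 2 * M + 1 with hx
  set u : ℝ := 1 + 2 * M / r with hu
  have hx1 : 1 ≤ x := by linarith
  have hu0 : 0 < u := by positivity
  have hQ1 : 1 ≤ Q := one_le_pow₀ (by norm_num)
  have q1 : Q ≤ u * h r := Q_le H hk M r hr1
  have q2 : Q ≤ x ^ β := Q_le' H hk M
  have hxu : x ≤ r * u := by
    have : r * u = r + 2 * (M : ℝ) := by rw [hu]; field_simp
    rw [this]; linarith
  set ε := (1 - β) / 2 with hε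
  have hε0 : 0 < ε := by positivity
  have hlog : Real.log (x * Q) ≤ 2 * (x ^ ε / ε) := by
    have a := Real.log_le_rpow_div (show 0 ≤ x by linarith) hε0
    have b : Real.log (x * Q) ≤ Real.log (x ^ 2) := by
      refine Real.log_le_log (by positivity) ?_
      have : x ^ β ≤ x ^ (1:ℝ) := Real.rpow_le_rpow_of_exponent_le hx1 H.b1.le
      rw [Real.rpow_one] at this
      nlinarith
    rw [Real.log_pow] at b
    push_cast at b
    linarith
  have hsq : √Q ≤ x ^ (β / 2) := by
    rw [Real.sqrt_le_left (by positivity), ← Real.rpow_natCast, ← Real.rpow_mul (by linarith)]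
    refine q2.trans (le_of_eq ?_)
    congr 1; push_cast; ring
  have hxx : x ^ (β / 2) * x ^ ε = √x := by
    rw [← Real.rpow_add (by linarith), Real.sqrt_eq_rpow]
    congr 1; rw [hε]; ring
  have hQl : Q * Real.log (x * Q) ≤ 2 / ε * √(x * Q) := by
    calc Q * Real.log (x * Q) ≤ Q * (2 * (x ^ ε / ε)) := by gcongr
      _ = 2 / ε * (√Q * (√Q * x ^ ε)) := by
          nth_rewrite 1 [← Real.mul_self_sqrt (show 0 ≤ Q by linarith)]; ring
      _ ≤ 2 / ε * (√Q * (x ^ (β / 2) * x ^ ε)) := by gcongr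
      _ = _ := by rw [hxx, Real.sqrt_mul (by linarith)]; ring
  have hN : (NN m M : ℝ) ≤ 2 / ε * √(x * Q) + 1 := by
    unfold NN
    push_cast
    have : 0 ≤ Q * Real.log (x * Q) := mul_nonneg (by linarith) (Real.log_nonneg (by nlinarith))
    have := Nat.floor_le this
    linarith
  set w := √(x * Q) with hw
  have hw1 : 1 ≤ w := by rw [hw, Real.one_le_sqrt]; nlinarith
  have hwu : w ≤ √(r * h r) * u := by
    rw [hw, Real.sqrt_le_left (by positivity), mul_pow, Real.sq_sqrt (by positivity)]
    calc x * Q ≤ (r * u) * (u * h r) := mul_le_mul hxu q1 (by linarith) (by positivity)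
      _ = _ := by ring
  have h18 : 36 / (1 - β) = 18 / ε := by rw [hε]; field_simp; norm_num
  rw [h18]
  have a1 : (NN m M : ℝ) * (18 * M + 8) ≤ (2 / ε * w + 1) * (9 * x) := by
    refine mul_le_mul hN (by linarith) (by positivity) (by positivity)
  calc (NN m M : ℝ) * (18 * M + 8) + (7 * M + 3) ≤ (2 / ε * w + 1) * (9 * x) + 4 * x := by linarith
    _ = 18 / ε * (x * w) + 13 * x := by ring
    _ ≤ 18 / ε * (x * w) + 13 * (x * w) := by nlinarith
    _ = (18 / ε + 13) * (x * w) := by ring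
    _ ≤ (18 / ε + 13) * ((r * u) * (√(r * h r) * u)) := by
        refine mul_le_mul_of_nonneg_left ?_ (by positivity)
        exact mul_le_mul hxu hwu (by linarith) (by positivity)
    _ = _ := by ring

lemma main_bd (H : Prof β h) (hm : ∀ s ≤ 0, m s = 0)
    (hk : ∀ d : ℕ, 1 ≤ d → (2:ℝ) ^ kap m d ≤ h d ∧ h d ≤ 2 * (2:ℝ) ^ kap m d)
    (n : ℕ) (hn : 1 ≤ n) (r F : ℝ) (hr1 : 1 ≤ r) (hr : r ^ 2 = n) (hF : 0 < F)
    (hFF : F ^ 2 = n * (r * h r)) :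
    (speed (SS m) (mu (sG m)) n ≤ (18 + 34 * (36 / (1 - β) + 13)) * F ∧
     F ≤ 2 * √(112 / (1 - β)) * speed (SS m) (mu (sG m)) n) ∧
    (entropy (convPow (mu (sG m)) n) ≤ 442 * (F ^ 2 * Real.log (n + 1) / n) ∧
      F ^ 2 * Real.log (n + 1) / n ≤ 4 * (112 / (1 - β)) / (1 - β) * entropy (convPow (mu (sG m)) n)) := by
  have hb : 0 < 1 - β := by linarith [H.b1]
  have hh := H.pos r hr1
  have hn0 : (0:ℝ) < n := by exact_mod_cast hn
  have hr0 : 0 < r := by linarith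
  set R := r * h r with hR
  have hR0 : 0 < R := by positivity
  set T := r / h r with hT
  have hT0 : 0 < T := by positivity
  have hRT : R * T = n := by rw [← hr, hR, hT]; field_simp
  have hFs : F = r * √R := by
    rw [← Real.sqrt_sq hF.le, hFF, ← hr, Real.sqrt_mul (by positivity), Real.sqrt_sq hr0.le]
  set q := √T with hq
  have hq0 : 0 < q := Real.sqrt_pos.2 hT0
  have hqq : T = q ^ 2 := (Real.sq_sqrt hT0.le).symm
  -- F * q = n
  have hFq : F * q = n := by
    rw [hFs, hq, mul_assoc, ← Real.sqrt_mul hR0.le, hRT, ← hr, Real.sqrt_sq hr0.le]; ring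
  have hRq : R * q = F := by
    have : R * q * q = F * q := by rw [hFq, ← hRT, hqq]; ring
    exact mul_right_cancel₀ hq0.ne' this
  set C := 112 / (1 - β) with hC
  have hC0 : 0 < C := by positivity
  have hC1 : 1 ≤ C := by rw [hC, le_div_iff₀ hb]; linarith [H.b0]
  have hP : EL BL n (fun l => (npr (sites m l) : ℝ)) ≤ C * (n * T) := pairs H hk n hn r hr1 hr
  have hV : EL BL n (fun l => VV m (Mx 0 l)) ≤ 34 * R := VV_bd H hk n hn r hr1 hr
  have hFn : F ^ 2 * Real.log (n + 1) / n = R * Real.log (n + 1) := by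
    rw [hFF]; field_simp
  have hM0 : 0 < C * T := by positivity
  refine ⟨⟨?_, ?_⟩, ?_, ?_⟩
  · refine (speed_le hm n q hq0).trans ?_
    have a1 : (n:ℝ) / q = F := by rw [← hFq]; field_simp
    have a2 : q * EL BL n (fun l => VV m (Mx 0 l)) ≤ 34 * F := by
      rw [← hRq]; nlinarith
    have a3 : EL BL n (fun l => (NN m (Mx 0 l) : ℝ) * (18 * Mx 0 l + 8) + (7 * Mx 0 l + 3)) ≤
        (36 / (1 - β) + 13) * F * 34 := by
      refine (EL_mono n fun l _ => NN_bd H hk (Mx 0 l) r hr1).trans ?_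
      rw [EL_mul_left, ← hR, ← hFs]
      exact mul_le_mul_of_nonneg_left (u_bd n hn r hr1 hr) (by positivity)
    rw [a1]; linarith
  · have a := speed_ge hm n (C * T) hM0
    have b : 13 / 16 * (n / (C * T)) ≤ n / (C * T) - 3 / 16 * EL BL n (fun l => (npr (sites m l) : ℝ)) / (C * T) ^ 2 := by
      have : EL BL n (fun l => (npr (sites m l) : ℝ)) / (C * T) ^ 2 ≤ n / (C * T) := by
        rw [div_le_div_iff₀ (by positivity) hM0]
        calc _ ≤ C * (n * T) * (C * T) := by gcongr
          _ = _ := by ring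
      rw [mul_div_assoc]; linarith
    have c := mul_le_mul_of_nonneg_left b (Real.sqrt_nonneg (C * T))
    have e : √(C * T) * (13 / 16 * (n / (C * T))) = 13 / 16 * (F / √C) := by
      rw [Real.sqrt_mul hC0.le, ← hq, hqq, ← hFq]
      have hs : C = √C ^ 2 := (Real.sq_sqrt hC0.le).symm
      have hs0 : 0 < √C := Real.sqrt_pos.2 hC0
      set s := √C with hsd
      rw [hs]
      field_simp
    have hs0 : 0 < √C := Real.sqrt_pos.2 hC0
    have d : 13 / 16 * (F / √C) ≤ speed (SS m) (mu (sG m)) n := by rw [← e]; exact c.trans a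
    have g : F = √C * (F / √C) := by field_simp
    have g0 : 0 ≤ F / √C := by positivity
    calc F = √C * (F / √C) := g
      _ ≤ √C * (2 * speed (SS m) (mu (sG m)) n) := by gcongr; linarith
      _ = _ := by ring
  · refine (entropy_up hm n hn).trans ?_
    rw [hFn]
    have hl : 0 ≤ Real.log ((n:ℝ) + 1) := Real.log_nonneg (by linarith)
    nlinarith [mul_le_mul_of_nonneg_left hV hl]
  · have a := entropy_ge (m := m) n (C * T) hM0
    rw [hFn]
    have hl1 : 0 ≤ Real.log (1 + C * T) := Real.log_nonneg (by linarith)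
    have b : n / (C * T) ≤ 2 * n / (C * T) - EL BL n (fun l => (npr (sites m l) : ℝ)) / (C * T) ^ 2 := by
      have : EL BL n (fun l => (npr (sites m l) : ℝ)) / (C * T) ^ 2 ≤ n / (C * T) := by
        rw [div_le_div_iff₀ (by positivity) hM0]
        calc _ ≤ C * (n * T) * (C * T) := by gcongr
          _ = _ := by ring
      rw [mul_div_assoc]; linarith
    have c := mul_le_mul_of_nonneg_left b (show 0 ≤ Real.log (1 + C * T) / 2 by positivity)
    have hlog : (1 - β) / 2 * Real.log (n + 1) ≤ Real.log (1 + C * T) := by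
      have e1 : ((n:ℝ) + 1) ^ ((1 - β) / 2) ≤ (n:ℝ) ^ ((1 - β) / 2) + 1 ^ ((1 - β) / 2) :=
        Real.rpow_add_le_add_rpow hn0.le zero_le_one (by positivity) (by linarith [H.b0])
      rw [Real.one_rpow] at e1
      have e2 : (n:ℝ) ^ ((1 - β) / 2) ≤ T := by
        rw [← hr, ← Real.rpow_natCast, ← Real.rpow_mul hr0.le, hT, le_div_iff₀ hh]
        have : ((2:ℕ):ℝ) * ((1 - β) / 2) = 1 - β := by push_cast; ring
        rw [this]
        calc r ^ (1 - β) * h r ≤ r ^ (1 - β) * r ^ β := by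
              gcongr; exact H.le_rpow hr1
          _ = r := by rw [← Real.rpow_add hr0]; simp
      rw [← Real.log_rpow (by linarith)]
      refine Real.log_le_log (by positivity) ?_
      nlinarith
    have e : (n:ℝ) / (C * T) = R / C := by rw [← hRT]; field_simp
    rw [e] at c
    have d : Real.log (1 + C * T) / 2 * (R / C) ≤ entropy (convPow (mu (sG m)) n) := by
      refine c.trans ?_
      rw [e] at b
      exact a
    have g : (1 - β) / 2 * Real.log (n + 1) / 2 * (R / C) ≤ entropy (convPow (mu (sG m)) n) := by
      refine le_trans ?_ d
      gcongr
    calc R * Real.log (n + 1) = 4 * C / (1 - β) * ((1 - β) / 2 * Real.log (n + 1) / 2 * (R / C)) := by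
          field_simp; norm_num
      _ ≤ _ := by gcongr
end

lemma prof_of (γ : ℝ) (hγ : γ ∈ Set.Ico (3 / 4 : ℝ) 1) (f : ℝ → ℝ)
    (hf : ∀ x : ℝ, 1 ≤ x → 0 < f x) (hf1 : f 1 = 1)
    (hL : ∀ a n : ℝ, 1 ≤ a → 1 ≤ n →
          a ^ ((3 : ℝ) / 4) * f n ≤ f (a * n) ∧ f (a * n) ≤ a ^ γ * f n) :
    Prof (4 * γ - 3) (fun x => f (x ^ 2) ^ 2 / x ^ 3) := by
  obtain ⟨g1, g2⟩ := hγ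
  refine ⟨by linarith, by linarith, by simp [hf1], ?_, ?_⟩
  · intro x hx
    have := hf (x ^ 2) (by nlinarith)
    positivity
  · intro a x ha hx
    have hx2 : 1 ≤ x ^ 2 := by nlinarith
    have ha0 : 0 < a := by linarith
    obtain ⟨l1, l2⟩ := hL (a ^ 2) (x ^ 2) (by nlinarith) hx2
    have hp := hf _ hx2
    have e : (a * x) ^ 2 = a ^ 2 * x ^ 2 := by ring
    have p1 : ∀ c : ℝ, ((a ^ 2) ^ c) ^ 2 = a ^ (4 * c) := by
      intro c
      rw [← Real.rpow_natCast a 2, ← Real.rpow_mul ha0.le, ← Real.rpow_natCast, ← Real.rpow_mul ha0.le]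
      congr 1; push_cast; ring
    have p3 : a ^ (4 * ((3:ℝ) / 4)) = a ^ 3 := by
      rw [← Real.rpow_natCast]; norm_num
    have hx0 : 0 < x := by linarith
    simp only [e]
    constructor
    · have : ((a ^ 2) ^ ((3:ℝ) / 4) * f (x ^ 2)) ^ 2 ≤ f (a ^ 2 * x ^ 2) ^ 2 := by gcongr
      rw [mul_pow, p1, p3] at this
      rw [div_le_div_iff₀ (by positivity) (by positivity)]
      calc f (x ^ 2) ^ 2 * (a * x) ^ 3 = (a ^ 3 * f (x ^ 2) ^ 2) * x ^ 3 := by ring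
        _ ≤ _ := by gcongr
    · have hp2 : 0 ≤ f (a ^ 2 * x ^ 2) := (hf _ (by nlinarith)).le
      have : f (a ^ 2 * x ^ 2) ^ 2 ≤ ((a ^ 2) ^ γ * f (x ^ 2)) ^ 2 := by gcongr
      rw [mul_pow, p1] at this
      have p4 : a ^ (4 * γ - 3) = a ^ (4 * γ) / a ^ 3 := by
        rw [Real.rpow_sub ha0]; congr 1; rw [← Real.rpow_natCast]; norm_num
      rw [p4, div_le_iff₀ (by positivity)]
      refine this.trans (le_of_eq ?_)
      field_simp

end SPE

/-- **Theorem 2, clause (1).** For any `γ ∈ [3/4, 1)` and any `f : [1,∞) → (0,∞)` with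
`f(1) = 1` satisfying the log-Lipschitz condition `a^{3/4} f(n) ≤ f(an) ≤ a^γ f(n)` for all
real `a, n ≥ 1`, there is a finitely generated group with a finite symmetric generating set
and a symmetric finitely supported random walk `X_n` on it with `E|X_n| ≍ f(n)` and
`H(X_n) ≍ f(n)² log(n+1) / n`, with implied constants depending only on `γ`. -/
theorem speed_prescribed_entropy_low
    (γ : ℝ) (hγ : γ ∈ Set.Ico (3 / 4 : ℝ) 1) :
    ∃ C : ℝ, 0 < C ∧
      ∀ f : ℝ → ℝ,
        (∀ x : ℝ, 1 ≤ x → 0 < f x) → f 1 = 1 →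
        (∀ a n : ℝ, 1 ≤ a → 1 ≤ n →
          a ^ ((3 : ℝ) / 4) * f n ≤ f (a * n) ∧ f (a * n) ≤ a ^ γ * f n) →
        ∃ (G : Type) (_ : Group G) (S : Set G) (μ : G → ℝ),
          IsGenSet S ∧ IsStepDist μ ∧
          ∀ n : ℕ, 1 ≤ n →
            (speed S μ n ≤ C * f n ∧ f n ≤ C * speed S μ n) ∧
            (entropy (convPow μ n) ≤ C * (f n ^ 2 * Real.log (n + 1) / n) ∧
              f n ^ 2 * Real.log (n + 1) / n ≤ C * entropy (convPow μ n)) := by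
  have hb : 0 < 1 - (4 * γ - 3) := by linarith [hγ.2]
  set b : ℝ := 1 - (4 * γ - 3) with hbd
  set C1 : ℝ := 18 + 34 * (36 / b + 13) with hC1
  set C2 : ℝ := 2 * √(112 / b) with hC2
  set C4 : ℝ := 4 * (112 / b) / b with hC4
  have p1 : 0 < C1 := by positivity
  have p2 : 0 ≤ C2 := by positivity
  have p4 : 0 < C4 := by positivity
  refine ⟨C1 + C2 + 442 + C4, by positivity, ?_⟩
  intro f hf hf1 hL
  have H := SPE.prof_of γ hγ f hf hf1 hL
  obtain ⟨m, hm, hk⟩ := H.mask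
  refine ⟨SPE.GG m, inferInstance, SPE.SS m, SPE.mu (SPE.sG m), SPE.isGen, SPE.isStep, ?_⟩
  intro n hn
  have hn1 : (1:ℝ) ≤ n := by exact_mod_cast hn
  have hr1 : 1 ≤ √(n:ℝ) := by rw [Real.one_le_sqrt]; exact hn1
  have hr : √(n:ℝ) ^ 2 = n := Real.sq_sqrt (by linarith)
  have hF := hf n hn1
  have hFF : f n ^ 2 = n * (√(n:ℝ) * (f (√(n:ℝ) ^ 2) ^ 2 / √(n:ℝ) ^ 3)) := by
    have : √(n:ℝ) ^ 3 = n * √(n:ℝ) := by rw [pow_succ, hr]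
    have h0 : (0:ℝ) < √(n:ℝ) := by linarith
    rw [this, hr]; field_simp
  obtain ⟨⟨s1, s2⟩, s3, s4⟩ := SPE.main_bd H hm hk n hn (√(n:ℝ)) (f n) hr1 hr hF hFF
  rw [← hbd] at s1 s2 s4
  have hl : 0 ≤ Real.log ((n:ℝ) + 1) := Real.log_nonneg (by linarith)
  have hX : 0 ≤ f n ^ 2 * Real.log (n + 1) / n := by positivity
  have hs : 0 ≤ speed (SPE.SS m) (SPE.mu (SPE.sG m)) n := by
    by_contra hc
    push Not at hc
    nlinarith
  have he : 0 ≤ entropy (convPow (SPE.mu (SPE.sG m)) n) := by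
    by_contra hc
    push Not at hc
    nlinarith
  refine ⟨⟨s1.trans ?_, s2.trans ?_⟩, s3.trans ?_, s4.trans ?_⟩
  · exact mul_le_mul_of_nonneg_right (by linarith) hF.le
  · exact mul_le_mul_of_nonneg_right (by linarith) hs
  · exact mul_le_mul_of_nonneg_right (by linarith) hX
  · exact mul_le_mul_of_nonneg_right (by linarith) he
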